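/- For every integer d ≥ 2, every β with 0 < β < arctanh(1/(d−1)) (the tree uniqueness threshold β_c(d), defined by tanh β_c(d) = 1/(d−1)), and every δ ∈ (0,1), there exists a constant c < 1 such that the following holds: for every finite graph G = (V,E) of maximum degree at most d, for the Ising measure μ_{G,β} on {−1,1}^V defined by μ_{G,β}(σ) proportional to exp(β·Σ_{{x,y}∈E} σ_x σ_y), for every f ∈ L²({−1,1}^V, μ_{G,β}) and every probability distribution ν of a random subset 𝒰 of V, independent of the spins, with revealment δ(𝒰) ≤ δ, one has E[clue(f|𝒰)] ≤ c. In particular, there is no random sparse reconstruction for Ising measures below the tree uniqueness threshold on graphs of bounded degree. -/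

import Mathlib

open Finset

namespace SR

/-- `p` is a probability mass function on the finite type `X`. -/
def IsPMF {X : Type*} [Fintype X] (p : X → ℝ) : Prop :=
  (∀ x, 0 ≤ p x) ∧ ∑ x : X, p x = 1

/-- Expectation of `f` under the pmf `p`. -/
noncomputable def pexp {X : Type*} [Fintype X] (p f : X → ℝ) : ℝ := ∑ x : X, p x * f x

/-- Variance of `f` under the pmf `p`. -/
noncomputable def pvar {X : Type*} [Fintype X] (p f : X → ℝ) : ℝ :=
  ∑ x : X, p x * (f x - pexp p f) ^ 2

/-- Conditional expectation of `f` given the coordinates in `U`. -/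
noncomputable def cexp {V : Type*} [Fintype V] [DecidableEq V]
    {Ω : Type*} [Fintype Ω] [DecidableEq Ω]
    (p : (V → Ω) → ℝ) (U : Finset V) (f : (V → Ω) → ℝ) : (V → Ω) → ℝ :=
  fun ω =>
    (∑ ω' ∈ univ.filter (fun ω' : V → Ω => ∀ v ∈ U, ω' v = ω v), p ω' * f ω') /
      ∑ ω' ∈ univ.filter (fun ω' : V → Ω => ∀ v ∈ U, ω' v = ω v), p ω'

/-- `clue(f|U) = Var(E[f|F_U])/Var(f)`, with the convention that it is `0` when `Var f = 0`. -/
noncomputable def clue {V : Type*} [Fintype V] [DecidableEq V]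
    {Ω : Type*} [Fintype Ω] [DecidableEq Ω]
    (p : (V → Ω) → ℝ) (f : (V → Ω) → ℝ) (U : Finset V) : ℝ :=
  if pvar p f = 0 then 0 else pvar p (cexp p U f) / pvar p f

/-- `ν` is a probability distribution on the subsets of `V` (a random subset of `V`). -/
def IsSubsetDist {V : Type*} [Fintype V] (ν : Finset V → ℝ) : Prop :=
  (∀ S, 0 ≤ ν S) ∧ ∑ S : Finset V, ν S = 1

/-- Expected clue `E[clue(f|𝒰)]` for a random subset with distribution `ν`. -/
noncomputable def eClue {V : Type*} [Fintype V] [DecidableEq V]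
    {Ω : Type*} [Fintype Ω] [DecidableEq Ω]
    (p : (V → Ω) → ℝ) (f : (V → Ω) → ℝ) (ν : Finset V → ℝ) : ℝ :=
  ∑ S : Finset V, ν S * clue p f S

/-- The revealment `δ(𝒰) = max_v P[v ∈ 𝒰]` of a random subset with distribution `ν`. -/
noncomputable def revealment {V : Type*} [Fintype V] [DecidableEq V] (ν : Finset V → ℝ) : ℝ :=
  sSup (Set.range fun v : V => ∑ S ∈ univ.filter (fun S : Finset V => v ∈ S), ν S)

/-- The spin `±1 ∈ ℝ` associated to a Boolean value. -/
noncomputable def spinR (b : Bool) : ℝ := if b then 1 else -1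

end SR

namespace SR

/-- The Ising energy `Σ_{{x,y} ∈ E} σ_x σ_y` of a spin configuration (each unordered edge
counted once, via half of the sum over ordered pairs). -/
noncomputable def isingInteraction {V : Type*} [Fintype V] (G : SimpleGraph V)
    [DecidableRel G.Adj] (σ : V → Bool) : ℝ :=
  (1 / 2) * ∑ x : V, ∑ y : V, if G.Adj x y then spinR (σ x) * spinR (σ y) else 0

/-- The Ising measure on a finite graph `G` at inverse temperature `β` (zero external field,
coupling constant `J = 1`): `μ_{G,β}(σ) ∝ exp(β·Σ_{{x,y}∈E} σ_x σ_y)`. -/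
noncomputable def isingPMF {V : Type*} [Fintype V] [DecidableEq V] (G : SimpleGraph V)
    [DecidableRel G.Adj] (β : ℝ) : (V → Bool) → ℝ :=
  fun σ => Real.exp (β * isingInteraction G σ) /
    ∑ τ : V → Bool, Real.exp (β * isingInteraction G τ)

end SR

open SR

namespace SR

section FKG

variable {V : Type*} [Fintype V] [DecidableEq V] {p : (V → Bool) → ℝ}

/-- A strictly positive probability mass function on `{0,1}^V` satisfying the FKG lattice
condition. -/
structure IsFKG (p : (V → Bool) → ℝ) : Prop where
  pos : ∀ σ, 0 < p σ
  sum_one : ∑ σ, p σ = 1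
  lattice : ∀ a b, p a * p b ≤ p (a ⊓ b) * p (a ⊔ b)

/-- The function `f` depends only on the coordinates in `U`. -/
def DepOn (U : Finset V) (f : (V → Bool) → ℝ) : Prop :=
  ∀ ω ω', (∀ v ∈ U, ω' v = ω v) → f ω' = f ω

omit [Fintype V] [DecidableEq V] in
lemma DepOn.mono {U U' : Finset V} (h : U ⊆ U') {f : (V → Bool) → ℝ} (hf : DepOn U f) :
    DepOn U' f := fun ω ω' hω => hf ω ω' fun v hv => hω v (h hv)

/-- The weight `p` restricted to the configurations which agree with `ω` on `U`. -/
noncomputable def cylWeight (p : (V → Bool) → ℝ) (U : Finset V) (ω ω' : V → Bool) : ℝ :=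
  if ∀ v ∈ U, ω' v = ω v then p ω' else 0

lemma cexp_eq (U : Finset V) (f : (V → Bool) → ℝ) (ω : V → Bool) :
    cexp p U f ω = (∑ ω', cylWeight p U ω ω' * f ω') / ∑ ω', cylWeight p U ω ω' := by
  simp [cexp, cylWeight, Finset.sum_filter, ite_mul]

lemma IsFKG.cylWeight_nonneg (hp : IsFKG p) (U : Finset V) (ω ω' : V → Bool) :
    0 ≤ cylWeight p U ω ω' := by
  unfold cylWeight; split_ifs
  exacts [(hp.pos _).le, le_rfl]

lemma IsFKG.sum_cylWeight_pos (hp : IsFKG p) (U : Finset V) (ω : V → Bool) :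
    0 < ∑ ω', cylWeight p U ω ω' :=
  Finset.sum_pos' (fun _ _ => hp.cylWeight_nonneg _ _ _)
    ⟨ω, mem_univ _, by simpa [cylWeight] using hp.pos ω⟩

lemma cylWeight_congr {U : Finset V} {ω₁ ω₂ : V → Bool} (h : ∀ v ∈ U, ω₁ v = ω₂ v) :
    cylWeight p U ω₁ = cylWeight p U ω₂ := by
  funext ω'
  have : (∀ v ∈ U, ω' v = ω₁ v) ↔ ∀ v ∈ U, ω' v = ω₂ v :=
    forall₂_congr fun v hv => by rw [h v hv]
  simp only [cylWeight, this]

lemma cexp_depOn (U : Finset V) (f : (V → Bool) → ℝ) : DepOn U (cexp p U f) := by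
  intro ω ω' h
  rw [cexp_eq, cexp_eq, cylWeight_congr h]

lemma IsFKG.cexp_le (hp : IsFKG p) (U : Finset V) {f : (V → Bool) → ℝ} {ω : V → Bool} {C : ℝ}
    (h : ∀ ω', (∀ v ∈ U, ω' v = ω v) → f ω' ≤ C) : cexp p U f ω ≤ C := by
  rw [cexp_eq, div_le_iff₀ (hp.sum_cylWeight_pos U ω), Finset.mul_sum]
  refine Finset.sum_le_sum fun ω' _ => ?_
  unfold cylWeight
  split_ifs with h'
  · rw [mul_comm]
    exact mul_le_mul_of_nonneg_right (h _ h') (hp.pos _).le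
  · simp

lemma cexp_add (U : Finset V) (f g : (V → Bool) → ℝ) :
    cexp p U (f + g) = cexp p U f + cexp p U g := by
  funext ω
  simp [cexp_eq, mul_add, Finset.sum_add_distrib, add_div]

lemma cexp_smul (U : Finset V) (c : ℝ) (f : (V → Bool) → ℝ) :
    cexp p U (c • f) = c • cexp p U f := by
  funext ω
  simp only [cexp_eq, Pi.smul_apply, smul_eq_mul, ← mul_div_assoc, Finset.mul_sum]
  congr 1
  exact Finset.sum_congr rfl fun _ _ => by ring

/-- Conditional expectation given the coordinates in `U`, as a linear endomorphism. -/
noncomputable def condE (p : (V → Bool) → ℝ) (U : Finset V) :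
    Module.End ℝ ((V → Bool) → ℝ) where
  toFun := cexp p U
  map_add' := cexp_add U
  map_smul' := cexp_smul U

@[simp] lemma condE_apply (U : Finset V) (f : (V → Bool) → ℝ) : condE p U f = cexp p U f := rfl

lemma cexp_mul_of_depOn {U : Finset V} {g : (V → Bool) → ℝ}
    (hg : DepOn U g) (f : (V → Bool) → ℝ) : cexp p U (g * f) = g * cexp p U f := by
  funext ω
  simp only [cexp_eq, Pi.mul_apply, ← mul_div_assoc, Finset.mul_sum]
  congr 1
  refine Finset.sum_congr rfl fun ω' _ => ?_
  unfold cylWeight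
  split_ifs with h
  · rw [hg ω ω' h]; ring
  · simp

lemma IsFKG.cexp_one (hp : IsFKG p) (U : Finset V) : cexp p U 1 = 1 := by
  funext ω
  simp [cexp_eq, (hp.sum_cylWeight_pos U ω).ne']

lemma IsFKG.cexp_of_depOn (hp : IsFKG p) {U : Finset V} {g : (V → Bool) → ℝ}
    (hg : DepOn U g) : cexp p U g = g := by
  simpa [hp.cexp_one] using cexp_mul_of_depOn (p := p) hg 1

lemma IsFKG.cexp_univ (hp : IsFKG p) (f : (V → Bool) → ℝ) : cexp p univ f = f :=
  hp.cexp_of_depOn fun ω ω' h => by rw [show ω' = ω from funext fun v => h v (mem_univ v)]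

lemma pexp_cexp_mul (U : Finset V) (f g : (V → Bool) → ℝ) :
    pexp p (cexp p U f * g) = pexp p (f * cexp p U g) := by
  simp only [pexp, Pi.mul_apply, cexp_eq, div_mul_eq_mul_div, ← mul_div_assoc, Finset.sum_mul,
    Finset.mul_sum, Finset.sum_div]
  rw [Finset.sum_comm]
  refine Finset.sum_congr rfl fun ω _ => Finset.sum_congr rfl fun ω' _ => ?_
  by_cases h : ∀ v ∈ U, ω v = ω' v
  · have h' : ∀ v ∈ U, ω' v = ω v := fun v hv => (h v hv).symm
    rw [cylWeight_congr h, show cylWeight p U ω' ω = p ω from if_pos h,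
      show cylWeight p U ω' ω' = p ω' from if_pos fun _ _ => rfl]
    ring
  · have h' : ¬ ∀ v ∈ U, ω' v = ω v := fun h' => h fun v hv => (h' v hv).symm
    simp [cylWeight, h, h']

lemma IsFKG.pexp_cexp (hp : IsFKG p) (U : Finset V) (f : (V → Bool) → ℝ) :
    pexp p (cexp p U f) = pexp p f := by
  simpa [hp.cexp_one] using pexp_cexp_mul (p := p) U f 1

lemma IsFKG.cexp_cexp_of_subset (hp : IsFKG p) {U U' : Finset V} (hU : U ⊆ U')
    (f : (V → Bool) → ℝ) : cexp p U (cexp p U' f) = cexp p U f := by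
  funext ω
  set g : (V → Bool) → ℝ := fun ω' => if ∀ v ∈ U, ω' v = ω v then 1 else 0 with hg
  have hgd : DepOn U g := by
    intro ω₁ ω₂ h
    have : (∀ v ∈ U, ω₂ v = ω v) ↔ ∀ v ∈ U, ω₁ v = ω v :=
      forall₂_congr fun v hv => by rw [h v hv]
    simp only [hg, this]
  have key : ∀ F : (V → Bool) → ℝ, ∑ ω', cylWeight p U ω ω' * F ω' = pexp p (g * F) := by
    intro F
    refine Finset.sum_congr rfl fun ω' _ => ?_
    simp only [cylWeight, hg, Pi.mul_apply]
    split_ifs <;> simp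
  rw [cexp_eq, cexp_eq, key, key, ← pexp_cexp_mul, hp.cexp_of_depOn (hgd.mono hU)]

lemma cexp_nonneg_lattice_aux (hp : IsFKG p) (U : Finset V) {ω₁ ω₂ : V → Bool} (h : ω₁ ≤ ω₂)
    (a b : V → Bool) : cylWeight p U ω₁ a * cylWeight p U ω₂ b ≤
      cylWeight p U ω₁ (a ⊓ b) * cylWeight p U ω₂ (a ⊔ b) := by
  by_cases ha : ∀ v ∈ U, a v = ω₁ v
  · by_cases hb : ∀ v ∈ U, b v = ω₂ v
    · have h1 : ∀ v ∈ U, (a ⊓ b) v = ω₁ v := fun v hv => by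
        rw [Pi.inf_apply, ha v hv, hb v hv]; exact inf_eq_left.2 (h v)
      have h2 : ∀ v ∈ U, (a ⊔ b) v = ω₂ v := fun v hv => by
        rw [Pi.sup_apply, ha v hv, hb v hv]; exact sup_eq_right.2 (h v)
      simp only [cylWeight, if_pos ha, if_pos hb, if_pos h1, if_pos h2]
      exact hp.lattice a b
    · rw [show cylWeight p U ω₂ b = 0 from if_neg hb, mul_zero]
      exact mul_nonneg (hp.cylWeight_nonneg _ _ _) (hp.cylWeight_nonneg _ _ _)
  · rw [show cylWeight p U ω₁ a = 0 from if_neg ha, zero_mul]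
    exact mul_nonneg (hp.cylWeight_nonneg _ _ _) (hp.cylWeight_nonneg _ _ _)

lemma exists_nonneg_shift {X : Type*} [Finite X] (f : X → ℝ) : ∃ c : ℝ, 0 ≤ f + c • 1 := by
  obtain ⟨m, hm⟩ := (Set.finite_range f).bddBelow
  exact ⟨-m, fun x => by
    have := hm ⟨x, rfl⟩
    simp only [Pi.zero_apply, Pi.add_apply, Pi.smul_apply, Pi.one_apply, smul_eq_mul]
    linarith⟩

omit [Fintype V] [DecidableEq V] in
lemma monotone_shift {f : (V → Bool) → ℝ} (hf : Monotone f) (c : ℝ) :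
    Monotone (f + c • 1) := fun a b h => by simpa using hf h

lemma IsFKG.monotone_cexp (hp : IsFKG p) (U : Finset V) {f : (V → Bool) → ℝ}
    (hf : Monotone f) : Monotone (cexp p U f) := by
  have main : ∀ f : (V → Bool) → ℝ, 0 ≤ f → Monotone f → Monotone (cexp p U f) := by
    intro f hf0 hf ω₁ ω₂ h
    rw [cexp_eq, cexp_eq, div_le_div_iff₀ (hp.sum_cylWeight_pos _ _) (hp.sum_cylWeight_pos _ _),
      mul_comm (∑ ω', cylWeight p U ω₂ ω' * f ω')]
    have nn := hp.cylWeight_nonneg U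
    refine four_functions_theorem_univ (cylWeight p U ω₁ * f) (cylWeight p U ω₂)
      (cylWeight p U ω₁) (cylWeight p U ω₂ * f) (mul_nonneg (nn _) hf0) (nn _) (nn _)
      (mul_nonneg (nn _) hf0) fun a b => ?_
    simp only [Pi.mul_apply]
    calc _ = (cylWeight p U ω₁ a * cylWeight p U ω₂ b) * f a := by ring
      _ ≤ (cylWeight p U ω₁ (a ⊓ b) * cylWeight p U ω₂ (a ⊔ b)) * f (a ⊔ b) :=
        mul_le_mul (cexp_nonneg_lattice_aux hp U h a b) (hf le_sup_left) (hf0 _)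
          (mul_nonneg (nn _ _) (nn _ _))
      _ = _ := by ring
  obtain ⟨c, hc⟩ := exists_nonneg_shift f
  have := main _ hc (monotone_shift hf c)
  rw [cexp_add, cexp_smul, hp.cexp_one] at this
  intro a b h
  simpa using this h

lemma IsFKG.cexp_mul_le (hp : IsFKG p) (U : Finset V) {f g : (V → Bool) → ℝ}
    (hf : Monotone f) (hg : Monotone g) (ω : V → Bool) :
    cexp p U f ω * cexp p U g ω ≤ cexp p U (f * g) ω := by
  have main : ∀ f g : (V → Bool) → ℝ, 0 ≤ f → 0 ≤ g → Monotone f → Monotone g →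
      cexp p U f ω * cexp p U g ω ≤ cexp p U (f * g) ω := by
    intro f g hf0 hg0 hf hg
    have h := fkg f g (cylWeight p U ω) (hp.cylWeight_nonneg U ω) hf0 hg0 hf hg
      (cexp_nonneg_lattice_aux hp U le_rfl)
    have hD := hp.sum_cylWeight_pos U ω
    rw [cexp_eq, cexp_eq, cexp_eq, div_mul_div_comm, div_le_div_iff₀ (mul_pos hD hD) hD]
    simp only [Pi.mul_apply]
    nlinarith
  obtain ⟨c, hc⟩ := exists_nonneg_shift f
  obtain ⟨e, he⟩ := exists_nonneg_shift g
  have := main _ _ hc he (monotone_shift hf c) (monotone_shift hg e)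
  have e1 : (f + c • 1) * (g + e • 1) = f * g + e • f + c • g + (c * e) • (1 : (V → Bool) → ℝ) := by
    funext x; simp; ring
  rw [e1] at this
  simp only [cexp_add, cexp_smul, hp.cexp_one, Pi.add_apply, Pi.smul_apply, Pi.one_apply,
    smul_eq_mul] at this
  linarith

/-- Covariance under `p`, as a bilinear form. -/
noncomputable def covF (p : (V → Bool) → ℝ) :
    ((V → Bool) → ℝ) →ₗ[ℝ] ((V → Bool) → ℝ) →ₗ[ℝ] ℝ :=
  LinearMap.mk₂ ℝ (fun f g => pexp p (f * g) - pexp p f * pexp p g)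
    (fun f f' g => by simp [pexp, add_mul, mul_add, Finset.sum_add_distrib]; ring)
    (fun c f g => by
      simp only [pexp, Pi.mul_apply, Pi.smul_apply, smul_eq_mul, mul_sub, Finset.mul_sum,
        ← mul_assoc, Finset.sum_mul]
      congr 1 <;> refine Finset.sum_congr rfl fun _ _ => ?_
      · ring
      · refine Finset.sum_congr rfl fun _ _ => ?_
        ring)
    (fun f g g' => by simp [pexp, mul_add, Finset.sum_add_distrib]; ring)
    (fun c f g => by
      simp only [pexp, Pi.mul_apply, Pi.smul_apply, smul_eq_mul, mul_sub, Finset.mul_sum,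
        ← mul_assoc, Finset.sum_mul]
      congr 1 <;> refine Finset.sum_congr rfl fun _ _ => ?_
      · ring
      · refine Finset.sum_congr rfl fun _ _ => ?_
        ring)

lemma covF_apply (f g : (V → Bool) → ℝ) :
    covF p f g = pexp p (f * g) - pexp p f * pexp p g := rfl

lemma covF_comm (f g : (V → Bool) → ℝ) : covF p f g = covF p g f := by
  rw [covF_apply, covF_apply, mul_comm f, mul_comm (pexp p f)]

lemma IsFKG.pexp_eq_cexp (hp : IsFKG p) (f : (V → Bool) → ℝ) (ω : V → Bool) :
    cexp p ∅ f ω = pexp p f := by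
  simp [cexp, pexp, hp.sum_one]

lemma IsFKG.pvar_eq (hp : IsFKG p) (f : (V → Bool) → ℝ) : pvar p f = covF p f f := by
  have : ∀ x, p x * (f x - pexp p f) ^ 2 =
      p x * (f x * f x) - 2 * pexp p f * (p x * f x) + pexp p f ^ 2 * p x := fun x => by ring
  simp only [pvar, this, Finset.sum_add_distrib, Finset.sum_sub_distrib, ← Finset.mul_sum,
    hp.sum_one, covF_apply]
  simp only [pexp, Pi.mul_apply]
  ring

lemma IsFKG.covF_self_nonneg (hp : IsFKG p) (f : (V → Bool) → ℝ) : 0 ≤ covF p f f := by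
  rw [← hp.pvar_eq]
  exact Finset.sum_nonneg fun x _ => mul_nonneg (hp.pos x).le (sq_nonneg _)

lemma IsFKG.covF_nonneg (hp : IsFKG p) {f g : (V → Bool) → ℝ}
    (hf : Monotone f) (hg : Monotone g) : 0 ≤ covF p f g := by
  have := hp.cexp_mul_le ∅ hf hg ⊥
  simp only [hp.pexp_eq_cexp] at this
  rw [covF_apply]
  linarith

lemma IsFKG.covF_cexp_left (hp : IsFKG p) (U : Finset V) (f g : (V → Bool) → ℝ) :
    covF p (cexp p U f) g = covF p f (cexp p U g) := by
  rw [covF_apply, covF_apply, pexp_cexp_mul, hp.pexp_cexp, hp.pexp_cexp]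

lemma IsFKG.covF_cexp_cexp (hp : IsFKG p) (U : Finset V) (f g : (V → Bool) → ℝ) :
    covF p (cexp p U f) (cexp p U g) = covF p f (cexp p U g) := by
  rw [hp.covF_cexp_left, hp.cexp_cexp_of_subset subset_rfl]

/-- Revealing more coordinates increases the correlation of increasing functions. -/
lemma IsFKG.covF_cexp_le_of_subset (hp : IsFKG p) {U U' : Finset V} (hU : U ⊆ U')
    {f g : (V → Bool) → ℝ} (hf : Monotone f) (hg : Monotone g) :
    covF p f (cexp p U g) ≤ covF p f (cexp p U' g) := by
  set F := cexp p U' f with hF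
  set G := cexp p U' g with hG
  rw [← hp.covF_cexp_cexp U, ← hp.covF_cexp_cexp U', ← hp.cexp_cexp_of_subset hU f,
    ← hp.cexp_cexp_of_subset hU g, ← hF, ← hG]
  rw [covF_apply, covF_apply, hp.pexp_cexp U F, hp.pexp_cexp U G, ← hp.pexp_cexp U (F * G)]
  have : pexp p (cexp p U F * cexp p U G) ≤ pexp p (cexp p U (F * G)) := by
    refine Finset.sum_le_sum fun ω _ => ?_
    exact mul_le_mul_of_nonneg_left (hp.cexp_mul_le U (hp.monotone_cexp U' hf)
      (hp.monotone_cexp U' hg) ω) (hp.pos ω).le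
  linarith

/-- A function on `{0,1}^V` increasing in each coordinate separately is increasing. -/
lemma monotone_of_update {g : (V → Bool) → ℝ}
    (h : ∀ σ u, g (Function.update σ u false) ≤ g (Function.update σ u true)) : Monotone g := by
  have key : ∀ (s : Finset V) (a b : V → Bool), a ≤ b → (∀ v ∉ s, a v = b v) → g a ≤ g b := by
    intro s
    induction s using Finset.induction_on with
    | empty => intro a b _ hab; rw [show a = b from funext fun v => hab v (by simp)]
    | insert u s hu ih =>
      intro a b hle hab
      have h1 : g a ≤ g (Function.update a u (b u)) := by
        have hb := hle u
        rcases hau : a u with _ | _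
        · rcases hbu : b u with _ | _
          · rw [← hau, Function.update_eq_self]
          · have := h a u
            rwa [show Function.update a u false = a by rw [← hau, Function.update_eq_self]] at this
        · rw [hau] at hb
          have : b u = true := top_le_iff.1 hb
          rw [this, ← hau, Function.update_eq_self]
      refine h1.trans (ih _ _ ?_ ?_)
      · intro v
        by_cases hv : v = u
        · subst hv; simp
        · simpa [hv] using hle v
      · intro v hv
        by_cases hvu : v = u
        · subst hvu; simp
        · simpa [hvu] using hab v (by simp [hvu, hv])
  exact fun a b hab => key univ a b hab (by simp)

/-- The spin at `v`, as a real-valued function of the configuration. -/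
noncomputable def spinAt (v : V) : (V → Bool) → ℝ := fun σ => spinR (σ v)

omit [Fintype V] in
lemma spinAt_update (σ : V → Bool) (u v : V) (b : Bool) :
    spinAt v (Function.update σ u b) = if v = u then spinR b else spinAt v σ := by
  by_cases h : v = u
  · subst h; simp [spinAt]
  · simp [spinAt, h]

lemma monotone_spinAt (v : V) : Monotone (spinAt v) := monotone_of_update fun σ u => by
  rw [spinAt_update, spinAt_update]
  split_ifs <;> norm_num [spinR]

lemma monotone_sum_smul_spinAt_sub {a : V → ℝ} {g : (V → Bool) → ℝ}
    (h : ∀ σ u, g (Function.update σ u true) - g (Function.update σ u false) ≤ 2 * a u) :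
    Monotone (∑ u, a u • spinAt u - g) := by
  refine monotone_of_update fun σ u => ?_
  have e : ∀ b, (∑ w, a w • spinAt w) (Function.update σ u b) =
      a u * spinR b + ∑ w ∈ univ.erase u, a w * spinAt w σ := by
    intro b
    rw [Finset.sum_apply, ← Finset.add_sum_erase _ _ (mem_univ u)]
    congr 1
    · simp [spinAt_update]
    · refine Finset.sum_congr rfl fun w hw => ?_
      simp [spinAt_update, Finset.ne_of_mem_erase hw]
  have := h σ u
  simp only [Pi.sub_apply, e, spinR]
  norm_num
  linarith

/-- Correlations with an increasing function are controlled by discrete derivatives. -/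
lemma IsFKG.covF_le_sum (hp : IsFKG p) {a : V → ℝ} {f g : (V → Bool) → ℝ} (hf : Monotone f)
    (h : ∀ σ u, g (Function.update σ u true) - g (Function.update σ u false) ≤ 2 * a u) :
    covF p f g ≤ ∑ u, a u * covF p f (spinAt u) := by
  have := hp.covF_nonneg hf (monotone_sum_smul_spinAt_sub h)
  simp only [map_sub, map_sum, map_smul, smul_eq_mul] at this
  linarith

end FKG

end SR
namespace SR

section Dynamics

variable {V : Type*} [Fintype V] [DecidableEq V] {p : (V → Bool) → ℝ}

/-- The averaged conditional expectation operator of a random revealed set. -/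
noncomputable def revealOp (p : (V → Bool) → ℝ) (ν : Finset V → ℝ) :
    Module.End ℝ ((V → Bool) → ℝ) := ∑ S, ν S • condE p S

lemma revealOp_apply (ν : Finset V → ℝ) (f : (V → Bool) → ℝ) :
    revealOp p ν f = ∑ S, ν S • cexp p S f := by
  simp [revealOp, LinearMap.sum_apply]

/-- The operator `D` preserves increasing functions. -/
def MonoPres (D : Module.End ℝ ((V → Bool) → ℝ)) : Prop := ∀ f, Monotone f → Monotone (D f)

/-- The operator `A` produces smaller correlations of increasing functions than `B`. -/
def CovLE (p : (V → Bool) → ℝ) (A B : Module.End ℝ ((V → Bool) → ℝ)) : Prop :=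
  ∀ f g, Monotone f → Monotone g → covF p f (A g) ≤ covF p f (B g)

omit [Fintype V] [DecidableEq V] in
lemma MonoPres.mul {A B : Module.End ℝ ((V → Bool) → ℝ)} (hA : MonoPres A) (hB : MonoPres B) :
    MonoPres (A * B) := fun _f hf => hA _ (hB _ hf)

omit [Fintype V] [DecidableEq V] in
lemma MonoPres.one : MonoPres (1 : Module.End ℝ ((V → Bool) → ℝ)) := fun _f hf => hf

omit [Fintype V] [DecidableEq V] in
lemma MonoPres.pow {A : Module.End ℝ ((V → Bool) → ℝ)} (hA : MonoPres A) (n : ℕ) :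
    MonoPres (A ^ n) := by
  induction n with
  | zero => exact MonoPres.one
  | succ n ih => rw [pow_succ]; exact ih.mul hA

lemma IsFKG.monoPres_condE (hp : IsFKG p) (U : Finset V) : MonoPres (condE p U) :=
  fun _f hf => hp.monotone_cexp U hf

omit [Fintype V] [DecidableEq V] in
lemma MonoPres.smul {A : Module.End ℝ ((V → Bool) → ℝ)} (hA : MonoPres A) {c : ℝ} (hc : 0 ≤ c) :
    MonoPres (c • A) := fun f hf _ _ h => mul_le_mul_of_nonneg_left (hA f hf h) hc

omit [Fintype V] [DecidableEq V] in
lemma MonoPres.add {A B : Module.End ℝ ((V → Bool) → ℝ)} (hA : MonoPres A) (hB : MonoPres B) :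
    MonoPres (A + B) := fun f hf _ _ h => add_le_add (hA f hf h) (hB f hf h)

lemma IsFKG.monoPres_revealOp (hp : IsFKG p) {ν : Finset V → ℝ} (hν : ∀ S, 0 ≤ ν S) :
    MonoPres (revealOp p ν) := by
  intro f hf a b h
  simp only [revealOp_apply, Finset.sum_apply, Pi.smul_apply, smul_eq_mul]
  exact Finset.sum_le_sum fun S _ =>
    mul_le_mul_of_nonneg_left (hp.monotone_cexp S hf h) (hν S)

lemma IsFKG.covF_revealOp_left (hp : IsFKG p) (ν : Finset V → ℝ) (f g : (V → Bool) → ℝ) :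
    covF p (revealOp p ν f) g = covF p f (revealOp p ν g) := by
  simp [revealOp_apply, map_sum, LinearMap.sum_apply, hp.covF_cexp_left]

lemma IsFKG.covF_revealOp_pow_left (hp : IsFKG p) (ν : Finset V → ℝ) (n : ℕ)
    (f g : (V → Bool) → ℝ) :
    covF p ((revealOp p ν ^ n) f) g = covF p f ((revealOp p ν ^ n) g) := by
  induction n generalizing g with
  | zero => rfl
  | succ n ih =>
    rw [pow_succ', Module.End.mul_apply, hp.covF_revealOp_left, ih, ← Module.End.mul_apply,
      ← pow_succ, pow_succ']

/-- Censoring: comparison of a power of the averaged operator with a composition. -/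
lemma IsFKG.covLE_pow_succ (hp : IsFKG p) {ν : Finset V → ℝ} (hν : ∀ S, 0 ≤ ν S)
    {B D : Module.End ℝ ((V → Bool) → ℝ)} (hB : CovLE p (revealOp p ν) B) (hD : MonoPres D)
    {n : ℕ} (h : CovLE p (revealOp p ν ^ n) D) : CovLE p (revealOp p ν ^ (n + 1)) (B * D) := by
  intro f g hf hg
  rw [pow_succ', Module.End.mul_apply, Module.End.mul_apply, ← hp.covF_revealOp_left]
  refine (h _ _ (hp.monoPres_revealOp hν f hf) hg).trans ?_
  rw [hp.covF_revealOp_left]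
  exact hB _ _ hf (hD _ hg)

/-- The lazy heat-bath update at the site `w`. -/
noncomputable def lazySite (p : (V → Bool) → ℝ) (q : ℝ) (w : V) :
    Module.End ℝ ((V → Bool) → ℝ) := q • condE p {w}ᶜ + (1 - q) • 1

lemma lazySite_apply (q : ℝ) (w : V) (f : (V → Bool) → ℝ) :
    lazySite p q w f = q • cexp p {w}ᶜ f + (1 - q) • f := by
  simp [lazySite]

lemma IsFKG.monoPres_lazySite (hp : IsFKG p) {q : ℝ} (hq0 : 0 ≤ q) (hq1 : q ≤ 1) (w : V) :
    MonoPres (lazySite p q w) :=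
  ((hp.monoPres_condE _).smul hq0).add (MonoPres.one.smul (sub_nonneg.2 hq1))

lemma IsFKG.covLE_revealOp_one (hp : IsFKG p) {ν : Finset V → ℝ} (hν : IsSubsetDist ν) :
    CovLE p (revealOp p ν) 1 := by
  intro f g hf hg
  rw [revealOp_apply, map_sum]
  calc ∑ S, covF p f (ν S • cexp p S g) ≤ ∑ S, ν S * covF p f g := by
        refine Finset.sum_le_sum fun S _ => ?_
        rw [map_smul, smul_eq_mul]
        refine mul_le_mul_of_nonneg_left ?_ (hν.1 S)
        have := hp.covF_cexp_le_of_subset (subset_univ S) hf hg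
        rwa [hp.cexp_univ] at this
    _ = _ := by rw [← Finset.sum_mul, hν.2, one_mul]; rfl

lemma IsFKG.covLE_revealOp_lazySite (hp : IsFKG p) {ν : Finset V → ℝ} (hν : IsSubsetDist ν)
    {δ : ℝ} {w : V} (hδ : ∑ S ∈ univ.filter (fun S : Finset V => w ∈ S), ν S ≤ δ) :
    CovLE p (revealOp p ν) (lazySite p (1 - δ) w) := by
  intro f g hf hg
  set x := covF p f (cexp p {w}ᶜ g) with hx
  set y := covF p f g with hy
  have hxy : x ≤ y := by
    have := hp.covF_cexp_le_of_subset (subset_univ ({w}ᶜ : Finset V)) hf hg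
    rwa [hp.cexp_univ] at this
  have h1 : covF p f (revealOp p ν g) ≤ ∑ S, (ν S * x + (if w ∈ S then ν S else 0) * (y - x)) := by
    rw [revealOp_apply, map_sum]
    refine Finset.sum_le_sum fun S _ => ?_
    rw [map_smul, smul_eq_mul]
    split_ifs with hS
    · have := hp.covF_cexp_le_of_subset (subset_univ S) hf hg
      rw [hp.cexp_univ] at this
      nlinarith [mul_le_mul_of_nonneg_left this (hν.1 S)]
    · have := hp.covF_cexp_le_of_subset (U := S) (U' := {w}ᶜ)
        (fun v hv => by simpa using fun h : v = w => hS (h ▸ hv)) hf hg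
      simpa using mul_le_mul_of_nonneg_left this (hν.1 S)
  refine h1.trans ?_
  rw [Finset.sum_add_distrib, ← Finset.sum_mul, ← Finset.sum_mul, hν.2, ← Finset.sum_filter,
    lazySite_apply, map_add, map_smul, map_smul, smul_eq_mul, smul_eq_mul, ← hx, ← hy]
  nlinarith [mul_le_mul_of_nonneg_right hδ (sub_nonneg.2 hxy)]

/-- Successive lazy heat-bath updates along a list of sites. -/
noncomputable def sweep (p : (V → Bool) → ℝ) (q : ℝ) (l : List V) :
    Module.End ℝ ((V → Bool) → ℝ) := (l.map (lazySite p q)).prod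

lemma sweep_nil (q : ℝ) : sweep p q [] = 1 := rfl

lemma sweep_cons (q : ℝ) (w : V) (l : List V) :
    sweep p q (w :: l) = lazySite p q w * sweep p q l := by simp [sweep]

lemma sweep_append (q : ℝ) (l l' : List V) :
    sweep p q (l ++ l') = sweep p q l * sweep p q l' := by simp [sweep]

lemma sweep_replicate_flatten (q : ℝ) (l : List V) (k : ℕ) :
    sweep p q (List.replicate k l).flatten = sweep p q l ^ k := by
  induction k with
  | zero => simp [sweep]
  | succ k ih => rw [List.replicate_succ, List.flatten_cons, sweep_append, ih, pow_succ']

lemma IsFKG.monoPres_sweep (hp : IsFKG p) {q : ℝ} (hq0 : 0 ≤ q) (hq1 : q ≤ 1) (l : List V) :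
    MonoPres (sweep p q l) := by
  induction l with
  | nil => exact MonoPres.one
  | cons w l ih => rw [sweep_cons]; exact (hp.monoPres_lazySite hq0 hq1 w).mul ih

lemma IsFKG.covLE_pow_sweep (hp : IsFKG p) {ν : Finset V → ℝ} (hν : IsSubsetDist ν)
    {δ : ℝ} (hδ0 : 0 ≤ δ) (hδ1 : δ ≤ 1)
    (hδ : ∀ w, ∑ S ∈ univ.filter (fun S : Finset V => w ∈ S), ν S ≤ δ) (l : List V) {n : ℕ}
    (hn : l.length ≤ n) : CovLE p (revealOp p ν ^ n) (sweep p (1 - δ) l) := by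
  have hmono := hp.monoPres_sweep (q := 1 - δ) (by linarith) (by linarith)
  have h0 : ∀ l : List V, CovLE p (revealOp p ν ^ l.length) (sweep p (1 - δ) l) := by
    intro l
    induction l with
    | nil => exact fun f g _ _ => le_rfl
    | cons w l ih =>
      rw [sweep_cons]
      exact hp.covLE_pow_succ hν.1 (hp.covLE_revealOp_lazySite hν (hδ w)) (hmono l) ih
  induction n, hn using Nat.le_induction with
  | base => exact h0 l
  | succ n _ ih =>
    have := hp.covLE_pow_succ hν.1 (hp.covLE_revealOp_one hν) (hmono l) ih
    rwa [one_mul] at this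

/-- All single-site heat-bath updates give each spin value probability at least `κ`. -/
def SiteBound (p : (V → Bool) → ℝ) (κ : ℝ) : Prop :=
  ∀ h : (V → Bool) → ℝ, 0 ≤ h → ∀ w σ b, κ * h (Function.update σ w b) ≤ cexp p {w}ᶜ h σ

lemma SiteBound.le_sweep {κ q : ℝ} (hκ : SiteBound p κ) (hκ0 : 0 ≤ κ) (hq0 : 0 ≤ q)
    (hq1 : q ≤ 1) {h : (V → Bool) → ℝ} (hh : 0 ≤ h) (l : List V) :
    ∀ σ τ : V → Bool, (∀ v ∉ l, τ v = σ v) →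
      (q * κ) ^ l.length * h τ ≤ sweep p q l h σ := by
  induction l with
  | nil =>
    intro σ τ hστ
    rw [show τ = σ from funext fun v => hστ v (by simp)]
    simp [sweep_nil]
  | cons w l ih =>
    intro σ τ hστ
    have hnn : 0 ≤ sweep p q l h := fun σ =>
      (mul_nonneg (pow_nonneg (mul_nonneg hq0 hκ0) _) (hh σ)).trans (ih σ σ fun _ _ => rfl)
    rw [sweep_cons, Module.End.mul_apply, lazySite_apply]
    simp only [Pi.add_apply, Pi.smul_apply, smul_eq_mul, List.length_cons]
    have h1 := hκ _ hnn w σ (τ w)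
    have h2 := ih (Function.update σ w (τ w)) τ (fun v hv => by
      by_cases hvw : v = w
      · subst hvw; simp
      · simpa [hvw] using hστ v (by simp [hvw, hv]))
    have h3 : 0 ≤ (1 - q) * sweep p q l h σ := mul_nonneg (sub_nonneg.2 hq1) (hnn σ)
    calc _ = q * (κ * ((q * κ) ^ l.length * h τ)) := by ring
      _ ≤ q * cexp p {w}ᶜ (sweep p q l h) σ :=
        mul_le_mul_of_nonneg_left ((mul_le_mul_of_nonneg_left h2 hκ0).trans h1) hq0
      _ ≤ _ := le_add_of_nonneg_right h3

lemma IsFKG.cexp_sweep (hp : IsFKG p) (q : ℝ) {B : Finset V} {l : List V} (hl : ∀ w ∈ l, w ∈ B)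
    (f : (V → Bool) → ℝ) : cexp p Bᶜ (sweep p q l f) = cexp p Bᶜ f := by
  induction l with
  | nil => rfl
  | cons w l ih =>
    have hw : Bᶜ ⊆ ({w}ᶜ : Finset V) := by
      simpa using hl w (by simp)
    rw [sweep_cons, Module.End.mul_apply, lazySite_apply, cexp_add, cexp_smul, cexp_smul,
      hp.cexp_cexp_of_subset hw, ih fun w hw => hl w (by simp [hw]), ← add_smul]
    simp

lemma IsFKG.sweep_cexp (hp : IsFKG p) (q : ℝ) {B : Finset V} {l : List V} (hl : ∀ w ∈ l, w ∈ B)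
    (f : (V → Bool) → ℝ) : sweep p q l (cexp p Bᶜ f) = cexp p Bᶜ f := by
  induction l with
  | nil => rfl
  | cons w l ih =>
    have hw : Bᶜ ⊆ ({w}ᶜ : Finset V) := by
      simpa using hl w (by simp)
    rw [sweep_cons, Module.End.mul_apply, ih fun w hw => hl w (by simp [hw]), lazySite_apply,
      hp.cexp_of_depOn ((cexp_depOn Bᶜ f).mono hw), ← add_smul]
    simp

lemma IsFKG.sweep_one (hp : IsFKG p) (q : ℝ) (l : List V) : sweep p q l 1 = 1 := by
  have := hp.sweep_cexp q (B := univ) (l := l) (by simp) 1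
  rwa [hp.cexp_one] at this

/-- One sweep contracts functions with vanishing conditional expectation. -/
lemma IsFKG.sweep_le (hp : IsFKG p) {κ q : ℝ} (hκ : SiteBound p κ) (hκ0 : 0 ≤ κ) (hq0 : 0 ≤ q)
    (hq1 : q ≤ 1) {B : Finset V} {l : List V} (hl : ∀ w, w ∈ l ↔ w ∈ B)
    {h : (V → Bool) → ℝ} (hK : cexp p Bᶜ h = 0) {M : ℝ} (hM : ∀ σ, h σ ≤ M) (σ : V → Bool) :
    sweep p q l h σ ≤ (1 - (q * κ) ^ l.length) * M := by
  set ε := (q * κ) ^ l.length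
  set g : (V → Bool) → ℝ := M • 1 - h with hg
  have hg0 : 0 ≤ g := fun σ => by simpa [hg] using hM σ
  have h1 : cexp p Bᶜ (ε • g) σ ≤ sweep p q l g σ := by
    refine hp.cexp_le Bᶜ fun τ hτ => ?_
    refine hκ.le_sweep hκ0 hq0 hq1 hg0 l σ τ fun v hv => hτ v ?_
    simpa [← hl] using hv
  have h2 : cexp p Bᶜ g = M • 1 := by
    have : g + h = M • 1 := by simp [hg]
    rw [← hp.cexp_one Bᶜ, ← cexp_smul, ← this, cexp_add, hK, add_zero]
  rw [cexp_smul, h2, hg, map_sub, map_smul, hp.sweep_one] at h1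
  simp at h1
  linarith

lemma IsFKG.abs_sweep_pow_le (hp : IsFKG p) {κ q : ℝ} (hκ : SiteBound p κ) (hκ0 : 0 ≤ κ)
    (hq0 : 0 ≤ q) (hq1 : q ≤ 1) {B : Finset V} {l : List V} (hl : ∀ w, w ∈ l ↔ w ∈ B)
    {M : ℝ} (k : ℕ) : ∀ {h : (V → Bool) → ℝ}, cexp p Bᶜ h = 0 → (∀ σ, |h σ| ≤ M) → ∀ σ : V → Bool,
    |(sweep p q l ^ k) h σ| ≤ (1 - (q * κ) ^ l.length) ^ k * M := by
  induction k generalizing M with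
  | zero => intro h _ hM σ; simpa using hM σ
  | succ k ih =>
    intro h hK hM σ
    rw [pow_succ, Module.End.mul_apply, pow_succ, mul_assoc]
    refine ih ?_ (fun τ => ?_) σ
    · rw [hp.cexp_sweep q fun w hw => (hl w).1 hw, hK]
    · refine abs_le.2 ⟨?_, ?_⟩
      · have := hp.sweep_le hκ hκ0 hq0 hq1 hl (h := (-1 : ℝ) • h) (by rw [cexp_smul, hK, smul_zero])
          (M := M) (fun σ => by simpa using neg_le.1 (abs_le.1 (hM σ)).1) τ
        rw [map_smul] at this
        simp at this
        linarith
      · exact hp.sweep_le hκ hκ0 hq0 hq1 hl hK (fun σ => (abs_le.1 (hM σ)).2) τ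

/-- Single-site heat-bath updates in `B` preserve dependence on the coordinates in `C` only. -/
def SiteLocal (p : (V → Bool) → ℝ) (B C : Finset V) : Prop :=
  ∀ w ∈ B, ∀ f, DepOn C f → DepOn C (cexp p {w}ᶜ f)

lemma SiteLocal.sweep {B C : Finset V} (h : SiteLocal p B C) (q : ℝ) {l : List V}
    (hl : ∀ w ∈ l, w ∈ B) {f : (V → Bool) → ℝ} (hf : DepOn C f) : DepOn C (sweep p q l f) := by
  induction l with
  | nil => exact hf
  | cons w l ih =>
    have ih := ih fun w hw => hl w (by simp [hw])
    rw [sweep_cons, Module.End.mul_apply, lazySite_apply]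
    intro ω ω' hω
    simp only [Pi.add_apply, Pi.smul_apply]
    rw [h w (hl w (by simp)) _ ih ω ω' hω, ih ω ω' hω]

lemma SiteLocal.sweep_pow {B C : Finset V} (h : SiteLocal p B C) (q : ℝ) {l : List V}
    (hl : ∀ w ∈ l, w ∈ B) (k : ℕ) {f : (V → Bool) → ℝ} (hf : DepOn C f) :
    DepOn C ((SR.sweep p q l ^ k) f) := by
  induction k with
  | zero => exact hf
  | succ k ih => rw [pow_succ', Module.End.mul_apply]; exact h.sweep q hl ih

lemma spinR_abs (b : Bool) : |spinR b| = 1 := by cases b <;> norm_num [spinR]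

/-- Discrete derivatives of the spin at `v` after many sweeps of the block `B`. -/
lemma IsFKG.sweep_pow_spinAt_sub_le (hp : IsFKG p) {κ q : ℝ} (hκ : SiteBound p κ) (hκ0 : 0 ≤ κ)
    (hq0 : 0 ≤ q) (hq1 : q ≤ 1) {B C : Finset V} (hloc : SiteLocal p B C)
    {l : List V} (hl : ∀ w, w ∈ l ↔ w ∈ B) {v : V} (hv : v ∈ C) {b : V → ℝ}
    (hb0 : ∀ u, 0 ≤ b u)
    (hb : ∀ σ u, cexp p Bᶜ (spinAt v) (Function.update σ u true) -
      cexp p Bᶜ (spinAt v) (Function.update σ u false) ≤ 2 * b u) (k : ℕ) (σ : V → Bool) (u : V) :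
    (sweep p q l ^ k) (spinAt v) (Function.update σ u true) -
      (sweep p q l ^ k) (spinAt v) (Function.update σ u false) ≤
      2 * (b u + if u ∈ C then 2 * (1 - (q * κ) ^ l.length) ^ k else 0) := by
  split_ifs with hu
  · have hd : (sweep p q l ^ k) (spinAt v) = cexp p Bᶜ (spinAt v) +
        (sweep p q l ^ k) (spinAt v - cexp p Bᶜ (spinAt v)) := by
      have : ∀ k, (sweep p q l ^ k) (cexp p Bᶜ (spinAt v)) = cexp p Bᶜ (spinAt v) := by
        intro k
        induction k with
        | zero => rfl
        | succ k ih =>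
          rw [pow_succ, Module.End.mul_apply, hp.sweep_cexp q (fun w hw => (hl w).1 hw), ih]
      rw [map_sub, this]; abel
    have hs : ∀ σ, |spinAt v σ| ≤ 1 := fun σ => (spinR_abs _).le
    have hKs : ∀ σ, |cexp p Bᶜ (spinAt v) σ| ≤ 1 := by
      intro σ
      refine abs_le.2 ⟨?_, hp.cexp_le _ fun τ _ => (abs_le.1 (hs τ)).2⟩
      have := hp.cexp_le Bᶜ (f := (-1 : ℝ) • spinAt v) (ω := σ) (C := 1) fun τ _ => by
        simpa using neg_le.1 (abs_le.1 (hs τ)).1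
      rw [cexp_smul] at this
      simp at this
      linarith
    have hbd := hp.abs_sweep_pow_le hκ hκ0 hq0 hq1 hl (M := 2) k
      (h := spinAt v - cexp p Bᶜ (spinAt v))
      (by
        have := cexp_add (p := p) Bᶜ (spinAt v - cexp p Bᶜ (spinAt v)) (cexp p Bᶜ (spinAt v))
        rw [sub_add_cancel, hp.cexp_cexp_of_subset subset_rfl] at this
        simpa using this)
      (fun σ => (abs_sub _ _).trans (by linarith [hs σ, hKs σ]))
    have h1 := abs_le.1 (hbd (Function.update σ u true))
    have h2 := abs_le.1 (hbd (Function.update σ u false))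
    have h3 := hb σ u
    rw [hd]
    simp only [Pi.add_apply]
    linarith [h1.2, h2.1]
  · have hdep : DepOn C (spinAt v) := fun ω ω' h => by simp only [spinAt, h v hv]
    rw [hloc.sweep_pow q (fun w hw => (hl w).1 hw) k hdep (Function.update σ u true)
      (Function.update σ u false) fun w hw => by
        have : w ≠ u := fun h => hu (h ▸ hw)
        simp [this]]
    linarith [hb0 u]

end Dynamics

end SR
namespace SR

section Gap

variable {V : Type*} [Fintype V] [DecidableEq V] {p : (V → Bool) → ℝ}

/-- The total spin. -/
noncomputable def totalSpin (V : Type*) [Fintype V] : (V → Bool) → ℝ := ∑ v, spinAt v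

lemma monotone_totalSpin : Monotone (totalSpin V) := fun a b h => by
  simp only [totalSpin, Finset.sum_apply]
  exact Finset.sum_le_sum fun v _ => monotone_spinAt v h

/-- After `T` steps, correlations of increasing functions with a spin are at most a sub-convex
combination, of total mass at most `1 / 2`, of the correlations with the spins at time `0`. -/
def Halving (p : (V → Bool) → ℝ) (P : Module.End ℝ ((V → Bool) → ℝ)) (T : ℕ) : Prop :=
  ∀ v, ∃ a : V → ℝ, (∀ u, 0 ≤ a u) ∧ ∑ u, a u ≤ 1 / 2 ∧
    ∀ f, Monotone f → covF p f ((P ^ T) (spinAt v)) ≤ ∑ u, a u * covF p f (spinAt u)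

lemma IsFKG.covF_totalSpin_pow_le (hp : IsFKG p) {ν : Finset V → ℝ} (hν : ∀ S, 0 ≤ ν S) {T : ℕ}
    (hT : Halving p (revealOp p ν) T) :
    ∃ C : ℝ, 0 ≤ C ∧ ∀ k v,
      covF p (totalSpin V) ((revealOp p ν ^ (T * k)) (spinAt v)) ≤ C * (1 / 2) ^ k := by
  have hnn : ∀ u, 0 ≤ covF p (totalSpin V) (spinAt u) := fun u =>
    hp.covF_nonneg monotone_totalSpin (monotone_spinAt u)
  refine ⟨∑ u, covF p (totalSpin V) (spinAt u), Finset.sum_nonneg fun u _ => hnn u, ?_⟩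
  intro k
  induction k with
  | zero =>
    intro v
    simpa using Finset.single_le_sum (fun u _ => hnn u) (mem_univ v)
  | succ k ih =>
    intro v
    obtain ⟨a, ha0, ha1, ha⟩ := hT v
    have hmono := (hp.monoPres_revealOp hν).pow (T * k) _ (monotone_totalSpin (V := V))
    have := ha _ hmono
    simp only [hp.covF_revealOp_pow_left] at this
    rw [← Module.End.mul_apply, ← pow_add] at this
    rw [mul_add, mul_one]
    refine this.trans ?_
    set C := ∑ u, covF p (totalSpin V) (spinAt u)
    have hC : 0 ≤ C := Finset.sum_nonneg fun u _ => hnn u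
    calc _ ≤ ∑ u, a u * (C * (1 / 2) ^ k) :=
          Finset.sum_le_sum fun u _ => mul_le_mul_of_nonneg_left (ih u) (ha0 u)
      _ = (∑ u, a u) * (C * (1 / 2) ^ k) := (Finset.sum_mul _ _ _).symm
      _ ≤ 1 / 2 * (C * (1 / 2) ^ k) := mul_le_mul_of_nonneg_right ha1 (by positivity)
      _ = _ := by ring

omit [DecidableEq V] in
lemma exists_monotone_smul_totalSpin_sub (f : (V → Bool) → ℝ) :
    ∃ L : ℝ, 0 ≤ L ∧ Monotone (L • totalSpin V - f) ∧ Monotone (L • totalSpin V + f) := by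
  classical
  have hL : ∀ σ, |f σ| ≤ ∑ τ, |f τ| := fun σ =>
    Finset.single_le_sum (f := fun τ => |f τ|) (fun _ _ => abs_nonneg _) (mem_univ σ)
  have key : ∀ g : (V → Bool) → ℝ, (∀ σ, |g σ| ≤ ∑ τ, |f τ|) →
      Monotone ((∑ τ, |f τ|) • totalSpin V - g) := by
    intro g hg
    have := monotone_sum_smul_spinAt_sub (a := fun _ : V => ∑ τ, |f τ|) (g := g) fun σ u => by
      have h1 := (abs_le.1 (hg (Function.update σ u true))).2
      have h2 := (abs_le.1 (hg (Function.update σ u false))).1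
      linarith
    rwa [← Finset.smul_sum] at this
  refine ⟨∑ τ, |f τ|, Finset.sum_nonneg fun _ _ => abs_nonneg _, key f hL, ?_⟩
  have := key (-f) fun σ => by simpa using hL σ
  rwa [sub_neg_eq_add] at this

/-- The autocorrelation of an arbitrary function is dominated by that of the total spin. -/
lemma IsFKG.exists_covF_pow_le (hp : IsFKG p) {ν : Finset V → ℝ} (hν : ∀ S, 0 ≤ ν S)
    (f : (V → Bool) → ℝ) : ∃ L : ℝ, 0 ≤ L ∧ ∀ n, covF p f ((revealOp p ν ^ n) f) ≤
      L * covF p (totalSpin V) ((revealOp p ν ^ n) (totalSpin V)) := by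
  obtain ⟨L, hL0, hL1, hL2⟩ := exists_monotone_smul_totalSpin_sub f
  refine ⟨2 * L ^ 2, by positivity, fun n => ?_⟩
  set P := revealOp p ν ^ n with hP
  have hmono : MonoPres P := (hp.monoPres_revealOp hν).pow n
  set Φ := totalSpin V
  have hsymm : covF p f (P Φ) = covF p Φ (P f) := by
    rw [← hp.covF_revealOp_pow_left, covF_comm]
  have h1 := hp.covF_nonneg hL1 (hmono _ hL2)
  have h2 := hp.covF_nonneg hL2 (hmono _ hL1)
  simp only [map_sub, map_add, map_smul, LinearMap.sub_apply, LinearMap.add_apply,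
    LinearMap.smul_apply, smul_eq_mul, hsymm] at h1 h2
  have h3 : 0 ≤ covF p Φ (P Φ) := hp.covF_nonneg monotone_totalSpin (hmono _ monotone_totalSpin)
  nlinarith [mul_nonneg (sq_nonneg L) h3]

lemma IsFKG.covF_sq_le (hp : IsFKG p) (f g : (V → Bool) → ℝ) :
    covF p f g ^ 2 ≤ covF p f f * covF p g g := by
  have h : ∀ t : ℝ, 0 ≤ covF p g g * (t * t) + (-2 * covF p f g) * t + covF p f f := by
    intro t
    have := hp.covF_self_nonneg (f - t • g)
    simp only [map_sub, map_smul, LinearMap.sub_apply, LinearMap.smul_apply, smul_eq_mul,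
      covF_comm g f] at this
    linarith
  have := discrim_le_zero h
  unfold discrim at this
  nlinarith

lemma IsFKG.covF_revealOp_nonneg (hp : IsFKG p) {ν : Finset V → ℝ} (hν : ∀ S, 0 ≤ ν S)
    (f : (V → Bool) → ℝ) : 0 ≤ covF p f (revealOp p ν f) := by
  rw [revealOp_apply, map_sum]
  refine Finset.sum_nonneg fun S _ => ?_
  rw [map_smul, smul_eq_mul, ← hp.covF_cexp_cexp]
  exact mul_nonneg (hν S) (hp.covF_self_nonneg _)

/-- A spectral gap estimate from the halving of correlations. -/
lemma IsFKG.covF_revealOp_le (hp : IsFKG p) {ν : Finset V → ℝ} (hν : ∀ S, 0 ≤ ν S) {t : ℕ}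
    (hT : Halving p (revealOp p ν) (2 ^ t)) {c : ℝ} (hc0 : 0 ≤ c) (hc : c ^ (2 ^ t) = 1 / 2)
    (f : (V → Bool) → ℝ) : covF p f (revealOp p ν f) ≤ c * covF p f f := by
  set P := revealOp p ν with hPdef
  rcases (hp.covF_self_nonneg f).eq_or_lt with h0 | h0
  · have := hp.covF_sq_le f (P f)
    rw [← h0, zero_mul] at this
    rw [← h0, mul_zero, pow_eq_zero_iff two_ne_zero |>.1 (le_antisymm this (sq_nonneg _))]
  set m0 := covF p f f with hm0
  set r := covF p f (P f) / m0 with hr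
  have hr0 : 0 ≤ r := div_nonneg (hp.covF_revealOp_nonneg hν f) h0.le
  have hpow : ∀ j : ℕ, r ^ (2 ^ j) ≤ covF p f ((P ^ (2 ^ j)) f) / m0 := by
    intro j
    induction j with
    | zero => simp [hr]
    | succ j ih =>
      have h1 := hp.covF_sq_le f ((P ^ (2 ^ j)) f)
      rw [hPdef, hp.covF_revealOp_pow_left, ← hPdef, ← Module.End.mul_apply, ← pow_add, ← two_mul,
        ← pow_succ', ← hm0] at h1
      have h2 : (r ^ (2 ^ j)) ^ 2 ≤ (covF p f ((P ^ (2 ^ j)) f) / m0) ^ 2 :=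
        pow_le_pow_left₀ (by positivity) ih 2
      rw [show r ^ (2 ^ (j + 1)) = (r ^ (2 ^ j)) ^ 2 by rw [← pow_mul, ← pow_succ]]
      refine h2.trans ?_
      rw [div_pow, div_le_div_iff₀ (by positivity) h0]
      nlinarith [mul_le_mul_of_nonneg_right h1 h0.le]
  obtain ⟨L, hL0, hL⟩ := hp.exists_covF_pow_le hν f
  obtain ⟨C, hC0, hC⟩ := hp.covF_totalSpin_pow_le hν hT
  have hbound : ∀ s : ℕ, (2 * r ^ (2 ^ t)) ^ (2 ^ s) ≤ L * (Fintype.card V * C) / m0 := by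
    intro s
    have h1 := hpow (t + s)
    have h2 := hL (2 ^ (t + s))
    have h3 : covF p (totalSpin V) ((P ^ (2 ^ (t + s))) (totalSpin V)) ≤
        Fintype.card V * C * (1 / 2) ^ (2 ^ s) := by
      have e : (P ^ (2 ^ (t + s))) (totalSpin V) = ∑ v, (P ^ (2 ^ (t + s))) (spinAt v) := by
        rw [totalSpin, map_sum]
      rw [e, map_sum]
      calc _ ≤ ∑ _v : V, C * (1 / 2) ^ (2 ^ s) := Finset.sum_le_sum fun v _ => by
            rw [pow_add]; exact hC (2 ^ s) v
        _ = _ := by simp [mul_assoc]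
    have h4 : r ^ (2 ^ (t + s)) ≤ L * (Fintype.card V * C * (1 / 2) ^ (2 ^ s)) / m0 :=
      h1.trans (div_le_div_of_nonneg_right (h2.trans (mul_le_mul_of_nonneg_left h3 hL0)) h0.le)
    rw [mul_pow, ← pow_mul, ← pow_add]
    calc (2 : ℝ) ^ (2 ^ s) * r ^ (2 ^ (t + s)) ≤ 2 ^ (2 ^ s) *
          (L * (Fintype.card V * C * (1 / 2) ^ (2 ^ s)) / m0) :=
          mul_le_mul_of_nonneg_left h4 (by positivity)
      _ = (2 * (1 / 2)) ^ (2 ^ s) * (L * (Fintype.card V * C) / m0) := by rw [mul_pow]; ring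
      _ = _ := by norm_num
  have hle : 2 * r ^ (2 ^ t) ≤ 1 := by
    by_contra hlt
    push Not at hlt
    obtain ⟨n, hn⟩ := pow_unbounded_of_one_lt (L * (Fintype.card V * C) / m0) hlt
    have := hbound n
    have h5 : (2 * r ^ (2 ^ t)) ^ n ≤ (2 * r ^ (2 ^ t)) ^ (2 ^ n) :=
      pow_le_pow_right₀ hlt.le (Nat.lt_two_pow_self).le
    linarith
  have hrc : r ≤ c := by
    refine le_of_pow_le_pow_left₀ (n := 2 ^ t) (by positivity) hc0 ?_
    rw [hc]; linarith
  rwa [hr, div_le_iff₀ h0] at hrc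

lemma IsFKG.eClue_le (hp : IsFKG p) {ν : Finset V → ℝ} (hν : ∀ S, 0 ≤ ν S) {t : ℕ}
    (hT : Halving p (revealOp p ν) (2 ^ t)) {c : ℝ} (hc0 : 0 ≤ c) (hc : c ^ (2 ^ t) = 1 / 2)
    (f : (V → Bool) → ℝ) : eClue p f ν ≤ c := by
  unfold eClue clue
  by_cases h : pvar p f = 0
  · simpa [h] using hc0
  · have hpos : 0 < pvar p f := by
      rw [hp.pvar_eq] at h ⊢
      exact lt_of_le_of_ne (hp.covF_self_nonneg f) (Ne.symm h)
    simp only [if_neg h, ← mul_div_assoc]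
    rw [← Finset.sum_div, div_le_iff₀ hpos, hp.pvar_eq f]
    refine le_trans (le_of_eq ?_) (hp.covF_revealOp_le hν hT hc0 hc f)
    rw [revealOp_apply, map_sum]
    refine Finset.sum_congr rfl fun S _ => ?_
    rw [hp.pvar_eq, hp.covF_cexp_cexp, map_smul, smul_eq_mul]

end Gap

end SR
namespace SR

section Lipschitz

/-- The log-likelihood ratio transmitted through one edge of an Ising model. -/
noncomputable def edgeRatio (β x : ℝ) : ℝ :=
  Real.log (Real.exp β * Real.exp x + Real.exp (-β)) -
    Real.log (Real.exp (-β) * Real.exp x + Real.exp β)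

lemma abs_edgeRatio_sub_le {β : ℝ} (hβ : 0 ≤ β) (x y : ℝ) :
    |edgeRatio β x - edgeRatio β y| ≤ Real.tanh β * |x - y| := by
  have hd : ∀ z, HasDerivAt (edgeRatio β)
      (Real.exp β * Real.exp z / (Real.exp β * Real.exp z + Real.exp (-β)) -
        Real.exp (-β) * Real.exp z / (Real.exp (-β) * Real.exp z + Real.exp β)) z := by
    intro z
    have h1 := (((Real.hasDerivAt_exp z).const_mul (Real.exp β)).add_const (Real.exp (-β))).log
      (by positivity)
    have h2 := (((Real.hasDerivAt_exp z).const_mul (Real.exp (-β))).add_const (Real.exp β)).log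
      (by positivity)
    exact h1.sub h2
  have hb : ∀ z, ‖Real.exp β * Real.exp z / (Real.exp β * Real.exp z + Real.exp (-β)) -
        Real.exp (-β) * Real.exp z / (Real.exp (-β) * Real.exp z + Real.exp β)‖ ≤ Real.tanh β := by
    intro z
    have hB : 1 ≤ Real.exp β := Real.one_le_exp hβ
    rw [Real.exp_neg, Real.tanh_eq_sinh_div_cosh, Real.sinh_eq, Real.cosh_eq, Real.exp_neg]
    have hX : 0 < Real.exp z := Real.exp_pos z
    generalize Real.exp z = X at *
    generalize Real.exp β = b at *
    have hb0 : 0 < b := by linarith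
    have e1 : b * X / (b * X + b⁻¹) - b⁻¹ * X / (b⁻¹ * X + b) =
        X * (b ^ 4 - 1) / ((b ^ 2 * X + 1) * (X + b ^ 2)) := by
      field_simp
      ring
    have e2 : (b - b⁻¹) / 2 / ((b + b⁻¹) / 2) = (b ^ 2 - 1) / (b ^ 2 + 1) := by
      field_simp
    have hb4 : 0 ≤ b ^ 2 - 1 := by nlinarith
    have hb5 : 0 ≤ b ^ 4 - 1 := by nlinarith
    rw [e1, e2, Real.norm_of_nonneg (by positivity),
      div_le_div_iff₀ (by positivity) (by positivity)]
    have : 0 ≤ (b ^ 2 - 1) * (b ^ 2 * (X - 1) ^ 2) := by positivity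
    nlinarith
  have := Convex.norm_image_sub_le_of_norm_hasDerivWithin_le (s := Set.univ)
    (fun z _ => (hd z).hasDerivWithinAt) (fun z _ => hb z) convex_univ
    (Set.mem_univ y) (Set.mem_univ x)
  simpa [Real.norm_eq_abs] using this

lemma tanh_nonneg_of_nonneg {β : ℝ} (hβ : 0 ≤ β) : 0 ≤ Real.tanh β := by
  rw [Real.tanh_eq_sinh_div_cosh]
  exact div_nonneg (Real.sinh_nonneg_iff.2 hβ) (Real.cosh_pos β).le

end Lipschitz

section Field

variable {V : Type*} [Fintype V] [DecidableEq V] (G : SimpleGraph V) [DecidableRel G.Adj] (β : ℝ)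

/-- The energy in the volume `W` of an Ising configuration with external field `h`. -/
noncomputable def fieldEnergy (W : Finset V) (h : V → ℝ) (σ : V → Bool) : ℝ :=
  β * ((1 / 2) * ∑ x ∈ W, ∑ y ∈ W, if G.Adj x y then spinR (σ x) * spinR (σ y) else 0) +
    ∑ x ∈ W, h x * spinR (σ x)

/-- Add the constant `c` to the field `h` on the set `N`. -/
noncomputable def bump (N : Finset V) (c : ℝ) (h : V → ℝ) : V → ℝ :=
  fun x => h x + if x ∈ N then c else 0

/-- The configuration which is `true` exactly on `t`. -/
def indSpin (t : Finset V) : V → Bool := fun x => decide (x ∈ t)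

/-- The partition function in the volume `W` with external field `h`. -/
noncomputable def fieldZ (W : Finset V) (h : V → ℝ) : ℝ :=
  ∑ t ∈ W.powerset, Real.exp (fieldEnergy G β W h (indSpin t))

/-- The log-ratio of the likelihoods of the two spins at `v ∉ W`, in the volume `W ∪ {v}`. -/
noncomputable def logRatio (W : Finset V) (v : V) (h : V → ℝ) : ℝ :=
  2 * h v + (Real.log (fieldZ G β W (bump (W.filter (G.Adj v)) β h)) -
    Real.log (fieldZ G β W (bump (W.filter (G.Adj v)) (-β) h)))

variable {G β}

omit [Fintype V] in
lemma fieldZ_pos (W : Finset V) (h : V → ℝ) : 0 < fieldZ G β W h :=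
  Finset.sum_pos (fun _ _ => Real.exp_pos _) ⟨∅, Finset.empty_mem_powerset W⟩

omit [Fintype V] [DecidableEq V] in
lemma fieldEnergy_congr {W : Finset V} {h h' : V → ℝ} {σ σ' : V → Bool}
    (hh : ∀ x ∈ W, h x = h' x) (hσ : ∀ x ∈ W, σ x = σ' x) :
    fieldEnergy G β W h σ = fieldEnergy G β W h' σ' := by
  unfold fieldEnergy
  congr 1
  · congr 2
    refine Finset.sum_congr rfl fun x hx => Finset.sum_congr rfl fun y hy => ?_
    rw [hσ x hx, hσ y hy]
  · exact Finset.sum_congr rfl fun x hx => by rw [hh x hx, hσ x hx]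

omit [Fintype V] in
lemma fieldZ_congr {W : Finset V} {h h' : V → ℝ} (hh : ∀ x ∈ W, h x = h' x) :
    fieldZ G β W h = fieldZ G β W h' :=
  Finset.sum_congr rfl fun _ _ => by rw [fieldEnergy_congr hh fun _ _ => rfl]

omit [Fintype V] in
lemma fieldEnergy_insert {W : Finset V} {v : V} (hv : v ∉ W) (h : V → ℝ) (σ : V → Bool) :
    fieldEnergy G β (insert v W) h σ =
      fieldEnergy G β W (bump (W.filter (G.Adj v)) (β * spinR (σ v)) h) σ +
        h v * spinR (σ v) := by
  have e1 : ∑ x ∈ W, (if G.Adj x v then spinR (σ x) * spinR (σ v) else 0) =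
      spinR (σ v) * ∑ x ∈ W, if G.Adj v x then spinR (σ x) else 0 := by
    rw [Finset.mul_sum]
    refine Finset.sum_congr rfl fun x _ => ?_
    simp only [G.adj_comm x v]
    split_ifs <;> ring
  have e2 : ∑ x ∈ W, (if G.Adj v x then spinR (σ v) * spinR (σ x) else 0) =
      spinR (σ v) * ∑ x ∈ W, if G.Adj v x then spinR (σ x) else 0 := by
    rw [Finset.mul_sum]
    refine Finset.sum_congr rfl fun x _ => ?_
    split_ifs <;> ring
  have e3 : ∑ x ∈ W, bump (W.filter (G.Adj v)) (β * spinR (σ v)) h x * spinR (σ x) =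
      ∑ x ∈ W, h x * spinR (σ x) +
        β * spinR (σ v) * ∑ x ∈ W, if G.Adj v x then spinR (σ x) else 0 := by
    rw [Finset.mul_sum, ← Finset.sum_add_distrib]
    refine Finset.sum_congr rfl fun x hx => ?_
    simp only [bump, Finset.mem_filter, hx, true_and]
    split_ifs <;> ring
  unfold fieldEnergy
  rw [e3]
  simp only [Finset.sum_insert hv, Finset.sum_add_distrib, e1, e2, SimpleGraph.irrefl, if_false]
  ring

omit [Fintype V] in
lemma sum_powerset_insert_exp {W : Finset V} {v : V} (hv : v ∉ W) (h : V → ℝ) (g : ℝ → ℝ) :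
    ∑ t ∈ (insert v W).powerset,
        Real.exp (fieldEnergy G β (insert v W) h (indSpin t)) * g (spinR (indSpin t v)) =
      Real.exp (h v) * fieldZ G β W (bump (W.filter (G.Adj v)) β h) * g 1 +
        Real.exp (-h v) * fieldZ G β W (bump (W.filter (G.Adj v)) (-β) h) * g (-1) := by
  unfold fieldZ
  rw [Finset.sum_powerset_insert hv, add_comm]
  congr 1
  · rw [Finset.mul_sum, Finset.sum_mul]
    refine Finset.sum_congr rfl fun t ht => ?_
    rw [fieldEnergy_insert hv, ← Real.exp_add, add_comm]
    have : spinR (indSpin (insert v t) v) = 1 := by simp [spinR, indSpin]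
    rw [this, mul_one, mul_one]
    congr 3
    refine fieldEnergy_congr (fun _ _ => rfl) fun x hx => ?_
    have : x ≠ v := fun e => hv (e ▸ hx)
    simp [indSpin, this]
  · rw [Finset.mul_sum, Finset.sum_mul]
    refine Finset.sum_congr rfl fun t ht => ?_
    rw [fieldEnergy_insert hv, ← Real.exp_add, add_comm]
    have hvt : v ∉ t := fun e => hv (Finset.mem_powerset.1 ht e)
    have : spinR (indSpin t v) = -1 := by simp [spinR, indSpin, hvt]
    rw [this, mul_neg, mul_neg, mul_one, mul_one]

omit [Fintype V] in
lemma fieldZ_insert {W : Finset V} {v : V} (hv : v ∉ W) (h : V → ℝ) :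
    fieldZ G β (insert v W) h =
      Real.exp (h v) * fieldZ G β W (bump (W.filter (G.Adj v)) β h) +
        Real.exp (-h v) * fieldZ G β W (bump (W.filter (G.Adj v)) (-β) h) := by
  have := sum_powerset_insert_exp (G := G) (β := β) hv h fun _ => 1
  simp only [mul_one] at this
  exact this

omit [Fintype V] in
lemma exp_logRatio (W : Finset V) (v : V) (h : V → ℝ) :
    Real.exp (logRatio G β W v h) =
      (Real.exp (h v) * fieldZ G β W (bump (W.filter (G.Adj v)) β h)) /
        (Real.exp (-h v) * fieldZ G β W (bump (W.filter (G.Adj v)) (-β) h)) := by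
  rw [logRatio, ← Real.log_div (fieldZ_pos _ _).ne' (fieldZ_pos _ _).ne', Real.exp_add,
    Real.exp_log (div_pos (fieldZ_pos _ _) (fieldZ_pos _ _)), two_mul, Real.exp_add,
    Real.exp_neg]
  have := (fieldZ_pos (G := G) (β := β) W (bump (W.filter (G.Adj v)) (-β) h)).ne'
  field_simp

omit [Fintype V] in
/-- The effect of the field at `w` on the free energy. -/
lemma log_fieldZ_bump_sub {W : Finset V} {w : V} (hw : w ∈ W) (h : V → ℝ) :
    Real.log (fieldZ G β W (bump {w} β h)) - Real.log (fieldZ G β W (bump {w} (-β) h)) =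
      edgeRatio β (logRatio G β (W.erase w) w h) := by
  set W' := W.erase w with hW'
  have hwW' : w ∉ W' := Finset.notMem_erase w W
  have hW : W = insert w W' := (Finset.insert_erase hw).symm
  set A := Real.exp (h w) * fieldZ G β W' (bump (W'.filter (G.Adj w)) β h) with hA
  set B := Real.exp (-h w) * fieldZ G β W' (bump (W'.filter (G.Adj w)) (-β) h) with hB
  have hA0 : 0 < A := mul_pos (Real.exp_pos _) (fieldZ_pos _ _)
  have hB0 : 0 < B := mul_pos (Real.exp_pos _) (fieldZ_pos _ _)
  have key : ∀ c, fieldZ G β W (bump {w} c h) = Real.exp c * A + Real.exp (-c) * B := by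
    intro c
    have e : ∀ c', fieldZ G β W' (bump (W'.filter (G.Adj w)) c' (bump {w} c h)) =
        fieldZ G β W' (bump (W'.filter (G.Adj w)) c' h) := fun c' =>
      fieldZ_congr fun x hx => by
        have : x ≠ w := fun e => hwW' (e ▸ hx)
        simp [bump, this]
    rw [hW, fieldZ_insert hwW', e, e]
    have : bump {w} c h w = h w + c := by simp [bump]
    rw [this, hA, hB, neg_add, Real.exp_add, Real.exp_add]
    ring
  have hL : Real.exp (logRatio G β W' w h) = A / B := exp_logRatio W' w h
  rw [edgeRatio, hL, key, key, neg_neg]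
  have f1 : Real.exp β * A + Real.exp (-β) * B =
      B * (Real.exp β * (A / B) + Real.exp (-β)) := by field_simp
  have f2 : Real.exp (-β) * A + Real.exp β * B =
      B * (Real.exp (-β) * (A / B) + Real.exp β) := by field_simp
  rw [f1, f2, Real.log_mul hB0.ne' (by positivity), Real.log_mul hB0.ne' (by positivity)]
  ring

/-- `a` bounds the influences of the fields on the log-ratio at `v`. -/
def Influence (G : SimpleGraph V) [DecidableRel G.Adj] (β : ℝ) (W : Finset V) (v : V)
    (a : V → ℝ) : Prop :=
  (∀ u, 0 ≤ a u) ∧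
    ∀ h h', |logRatio G β W v h - logRatio G β W v h'| ≤ ∑ u, a u * |h u - h' u|

lemma abs_log_fieldZ_bump_sub_le (hβ : 0 ≤ β) {W : Finset V} {a : V → V → ℝ} (N : Finset V)
    (hN : ∀ w ∈ N, w ∈ W) (ha : ∀ w ∈ N, Influence G β (W.erase w) w (a w)) (h h' : V → ℝ) :
    |(Real.log (fieldZ G β W (bump N β h)) - Real.log (fieldZ G β W (bump N (-β) h))) -
      (Real.log (fieldZ G β W (bump N β h')) - Real.log (fieldZ G β W (bump N (-β) h')))| ≤
      Real.tanh β * ∑ w ∈ N, ∑ u, a w u * |h u - h' u| := by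
  induction N using Finset.induction_on generalizing h h' with
  | empty =>
    have : ∀ c h, bump (∅ : Finset V) c h = h := fun c h => by funext x; simp [bump]
    simp [this]
  | insert w N hwN ih =>
    have hw := ha w (mem_insert_self _ _)
    have e : ∀ c h, bump (insert w N) c h = bump N c (bump {w} c h) := by
      intro c h
      funext x
      simp only [bump, mem_insert, mem_singleton]
      by_cases hx : x = w
      · subst hx; simp [hwN]
      · simp [hx]
    have e' : ∀ c c' h, bump N c (bump {w} c' h) = bump {w} c' (bump N c h) := by
      intro c c' h
      funext x
      simp only [bump]
      ring
    have hsplit : ∀ h, Real.log (fieldZ G β W (bump (insert w N) β h)) -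
        Real.log (fieldZ G β W (bump (insert w N) (-β) h)) =
        (Real.log (fieldZ G β W (bump N β (bump {w} β h))) -
          Real.log (fieldZ G β W (bump N (-β) (bump {w} β h)))) +
        edgeRatio β (logRatio G β (W.erase w) w (bump N (-β) h)) := by
      intro h
      rw [← log_fieldZ_bump_sub (hN w (mem_insert_self _ _)), e, e, e' (-β) (-β), e' (-β) β]
      ring
    have hdiff : ∀ (M : Finset V) c u, bump M c h u - bump M c h' u = h u - h' u := by
      intro M c u
      simp [bump]
    have h1 := ih (fun x hx => hN x (mem_insert_of_mem hx))
      (fun x hx => ha x (mem_insert_of_mem hx)) (bump {w} β h) (bump {w} β h')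
    have h2 := abs_edgeRatio_sub_le hβ (logRatio G β (W.erase w) w (bump N (-β) h))
      (logRatio G β (W.erase w) w (bump N (-β) h'))
    have h3 := hw.2 (bump N (-β) h) (bump N (-β) h')
    have ht := tanh_nonneg_of_nonneg hβ
    simp only [hdiff] at h1 h3
    have h4 := mul_le_mul_of_nonneg_left h3 ht
    rw [hsplit, hsplit, Finset.sum_insert hwN, mul_add]
    rw [abs_le] at *
    constructor <;> linarith [h1.1, h1.2, h2.1, h2.2]

lemma Influence.step (hβ : 0 ≤ β) {W : Finset V} {v : V} {a : V → V → ℝ}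
    (ha : ∀ w ∈ W.filter (G.Adj v), Influence G β (W.erase w) w (a w)) :
    Influence G β W v fun u =>
      (if u = v then 2 else 0) + Real.tanh β * ∑ w ∈ W.filter (G.Adj v), a w u := by
  have ht := tanh_nonneg_of_nonneg hβ
  refine ⟨fun u => add_nonneg (by split_ifs <;> norm_num)
    (mul_nonneg ht (Finset.sum_nonneg fun w hw => (ha w hw).1 u)), fun h h' => ?_⟩
  have h1 := abs_log_fieldZ_bump_sub_le hβ (W.filter (G.Adj v))
    (fun w hw => (Finset.mem_filter.1 hw).1) ha h h'
  have h2 : |2 * h v - 2 * h' v| = 2 * |h v - h' v| := by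
    rw [← mul_sub, abs_mul, abs_two]
  have e : ∑ u, ((if u = v then 2 else 0) + Real.tanh β * ∑ w ∈ W.filter (G.Adj v), a w u) *
      |h u - h' u| = 2 * |h v - h' v| +
        Real.tanh β * ∑ w ∈ W.filter (G.Adj v), ∑ u, a w u * |h u - h' u| := by
    simp only [add_mul, Finset.sum_add_distrib, ite_mul, zero_mul, Finset.sum_ite_eq', mem_univ,
      if_true, mul_assoc, ← Finset.mul_sum, Finset.sum_mul]
    rw [Finset.sum_comm]
  rw [e]
  unfold logRatio
  rw [← h2]
  refine le_trans (le_of_eq ?_) ((abs_add_le _ _).trans (add_le_add_right h1 _))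
  congr 1
  ring

lemma Influence.sum_step {W : Finset V} {v : V} {a : V → V → ℝ} {φ : V → ℝ} {K lam : ℝ} {m : ℕ}
    {T : ℝ} (hT : 0 ≤ T) (hK : 0 ≤ K) (hφ0 : ∀ v, 0 ≤ φ v) (hlam : 0 ≤ lam)
    (hφ : ∀ v w, G.Adj v w → φ w ≤ lam * φ v) (hm : (W.filter (G.Adj v)).card ≤ m)
    (ha : ∀ w ∈ W.filter (G.Adj v), ∑ u, a w u * φ u ≤ K * φ w) :
    ∑ u, ((if u = v then 2 else 0) + T * ∑ w ∈ W.filter (G.Adj v), a w u) * φ u ≤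
      (2 + T * m * (K * lam)) * φ v := by
  have e : ∑ u, ((if u = v then 2 else 0) + T * ∑ w ∈ W.filter (G.Adj v), a w u) * φ u =
      2 * φ v + T * ∑ w ∈ W.filter (G.Adj v), ∑ u, a w u * φ u := by
    simp only [add_mul, Finset.sum_add_distrib, ite_mul, zero_mul, Finset.sum_ite_eq', mem_univ,
      if_true, mul_assoc, ← Finset.mul_sum, Finset.sum_mul]
    rw [Finset.sum_comm]
  rw [e, add_mul]
  refine add_le_add_right ?_ _
  have h1 : ∑ w ∈ W.filter (G.Adj v), ∑ u, a w u * φ u ≤ m * (K * (lam * φ v)) := by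
    calc _ ≤ ∑ w ∈ W.filter (G.Adj v), K * (lam * φ v) := Finset.sum_le_sum fun w hw =>
          (ha w hw).trans (mul_le_mul_of_nonneg_left (hφ v w (Finset.mem_filter.1 hw).2) hK)
      _ ≤ _ := by
          rw [Finset.sum_const, nsmul_eq_mul]
          have := hφ0 v
          exact mul_le_mul_of_nonneg_right (by exact_mod_cast hm) (by positivity)
  calc _ ≤ T * (m * (K * (lam * φ v))) := mul_le_mul_of_nonneg_left h1 hT
    _ = _ := by ring

/-- Combining the influences on the neighbours of `v` into influences on `v`. -/
lemma exists_influence_step (hβ : 0 ≤ β) {φ : V → ℝ} {lam K : ℝ} (hφ0 : ∀ v, 0 ≤ φ v)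
    (hlam : 0 ≤ lam) (hφ : ∀ v w, G.Adj v w → φ w ≤ lam * φ v) (hK : 0 ≤ K) {m : ℕ}
    {W : Finset V} {v : V} (hm : (W.filter (G.Adj v)).card ≤ m)
    (h : ∀ w ∈ W.filter (G.Adj v), ∃ a, Influence G β (W.erase w) w a ∧
      ∑ u, a u * φ u ≤ K * φ w) :
    ∃ a, Influence G β W v a ∧ ∑ u, a u * φ u ≤ (2 + Real.tanh β * m * (K * lam)) * φ v := by
  have h' : ∀ w, ∃ a, w ∈ W.filter (G.Adj v) → Influence G β (W.erase w) w a ∧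
      ∑ u, a u * φ u ≤ K * φ w := by
    intro w
    by_cases hw : w ∈ W.filter (G.Adj v)
    · obtain ⟨a, ha⟩ := h w hw
      exact ⟨a, fun _ => ha⟩
    · exact ⟨0, fun hw' => absurd hw' hw⟩
  choose a ha using h'
  exact ⟨_, Influence.step hβ fun w hw => (ha w hw).1,
    Influence.sum_step (tanh_nonneg_of_nonneg hβ) hK hφ0 hlam hφ hm fun w hw => (ha w hw).2⟩

omit [Fintype V] in
lemma filter_adj_erase_subset (W : Finset V) (w : V) :
    (W.erase w).filter (G.Adj w) ⊆ W.filter (G.Adj w) :=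
  Finset.filter_subset_filter _ (Finset.erase_subset _ _)

omit [DecidableEq V] in
lemma card_filter_adj_le (W : Finset V) (v : V) : (W.filter (G.Adj v)).card ≤ G.degree v := by
  rw [← G.card_neighborFinset_eq_degree]
  exact Finset.card_le_card fun x hx => by simpa using (Finset.mem_filter.1 hx).2

omit [DecidableEq V] in
lemma card_filter_adj_lt {W : Finset V} {v w : V} (hv : v ∉ W) (hvw : G.Adj v w) :
    (W.filter (G.Adj w)).card < G.degree w := by
  rw [← G.card_neighborFinset_eq_degree]
  refine Finset.card_lt_card (Finset.ssubset_iff_subset_ne.2 ⟨fun x hx => ?_, fun e => ?_⟩)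
  · simpa using (Finset.mem_filter.1 hx).2
  · have : v ∈ W.filter (G.Adj w) := by rw [e]; simpa using hvw.symm
    exact hv (Finset.mem_filter.1 this).1

/-- Below the tree uniqueness threshold, the influences decay exponentially away from a root
with at most `d - 1` neighbours. -/
lemma exists_influence_of_card_lt (hβ : 0 ≤ β) {d : ℕ} (hdeg : ∀ v, G.degree v ≤ d)
    {φ : V → ℝ} {lam K : ℝ} (hφ0 : ∀ v, 0 ≤ φ v) (hlam : 0 ≤ lam)
    (hφ : ∀ v w, G.Adj v w → φ w ≤ lam * φ v) (hK : 0 ≤ K)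
    (hKeq : 2 + Real.tanh β * (d - 1 : ℕ) * (K * lam) ≤ K) (W : Finset V) :
    ∀ v, v ∉ W → (W.filter (G.Adj v)).card ≤ d - 1 →
      ∃ a, Influence G β W v a ∧ ∑ u, a u * φ u ≤ K * φ v := by
  induction W using Finset.strongInduction with
  | H W ih =>
    intro v hv hcard
    obtain ⟨a, ha, ha'⟩ := exists_influence_step hβ hφ0 hlam hφ hK hcard fun w hw => by
      obtain ⟨hwW, hvw⟩ := Finset.mem_filter.1 hw
      refine ih _ (Finset.erase_ssubset hwW) w (Finset.notMem_erase w W) ?_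
      have h1 := card_filter_adj_lt hv hvw
      have h2 := Finset.card_le_card (filter_adj_erase_subset (G := G) W w)
      have h3 := hdeg w
      omega
    exact ⟨a, ha, ha'.trans (mul_le_mul_of_nonneg_right hKeq (hφ0 v))⟩

lemma exists_influence (hβ : 0 ≤ β) {d : ℕ} (hdeg : ∀ v, G.degree v ≤ d)
    {φ : V → ℝ} {lam K : ℝ} (hφ0 : ∀ v, 0 ≤ φ v) (hlam : 0 ≤ lam)
    (hφ : ∀ v w, G.Adj v w → φ w ≤ lam * φ v) (hK : 0 ≤ K)
    (hKeq : 2 + Real.tanh β * (d - 1 : ℕ) * (K * lam) ≤ K) {W : Finset V} {v : V} (hv : v ∉ W) :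
    ∃ a, Influence G β W v a ∧ ∑ u, a u * φ u ≤ (2 + Real.tanh β * d * (K * lam)) * φ v := by
  refine exists_influence_step hβ hφ0 hlam hφ hK ((card_filter_adj_le W v).trans (hdeg v))
    fun w hw => ?_
  obtain ⟨hwW, hvw⟩ := Finset.mem_filter.1 hw
  refine exists_influence_of_card_lt hβ hdeg hφ0 hlam hφ hK hKeq _ w
    (Finset.notMem_erase w W) ?_
  have h1 := card_filter_adj_lt hv hvw
  have h2 := Finset.card_le_card (filter_adj_erase_subset (G := G) W w)
  have h3 := hdeg w
  omega

end Field

end SR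
namespace SR

section Ising

variable {V : Type*} [Fintype V] [DecidableEq V] {G : SimpleGraph V} [DecidableRel G.Adj] {β : ℝ}

lemma isFKG_isingPMF (hβ : 0 ≤ β) : IsFKG (isingPMF G β) := by
  have hZ : 0 < ∑ τ : V → Bool, Real.exp (β * isingInteraction G τ) :=
    Finset.sum_pos (fun _ _ => Real.exp_pos _) univ_nonempty
  refine ⟨fun σ => div_pos (Real.exp_pos _) hZ, ?_, fun a b => ?_⟩
  · unfold isingPMF
    rw [← Finset.sum_div, div_self hZ.ne']
  · unfold isingPMF
    rw [div_mul_div_comm, div_mul_div_comm, ← Real.exp_add, ← Real.exp_add, ← mul_add, ← mul_add]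
    refine div_le_div_of_nonneg_right (Real.exp_le_exp.2 (mul_le_mul_of_nonneg_left ?_ hβ))
      (mul_pos hZ hZ).le
    unfold isingInteraction
    rw [← mul_add, ← mul_add, ← Finset.sum_add_distrib, ← Finset.sum_add_distrib]
    refine mul_le_mul_of_nonneg_left (Finset.sum_le_sum fun x _ => ?_) (by norm_num)
    rw [← Finset.sum_add_distrib, ← Finset.sum_add_distrib]
    refine Finset.sum_le_sum fun y _ => ?_
    split_ifs
    · simp only [Pi.inf_apply, Pi.sup_apply]
      cases a x <;> cases a y <;> cases b x <;> cases b y <;> norm_num [spinR]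
    · exact le_rfl

/-- The field induced on `B` by a configuration outside of `B`. -/
noncomputable def extField (G : SimpleGraph V) [DecidableRel G.Adj] (β : ℝ) (B : Finset V)
    (η : V → Bool) : V → ℝ :=
  fun w => if w ∈ B then β * ∑ x ∈ Bᶜ, if G.Adj w x then spinR (η x) else 0 else 0

/-- The interaction outside of `B`. -/
noncomputable def extEnergy (G : SimpleGraph V) [DecidableRel G.Adj] (β : ℝ) (B : Finset V)
    (η : V → Bool) : ℝ :=
  β * ((1 / 2) * ∑ x ∈ Bᶜ, ∑ y ∈ Bᶜ, if G.Adj x y then spinR (η x) * spinR (η y) else 0)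

lemma mul_isingInteraction_eq {B : Finset V} {η σ : V → Bool} (h : ∀ x ∉ B, σ x = η x) :
    β * isingInteraction G σ = fieldEnergy G β B (extField G β B η) σ + extEnergy G β B η := by
  set A : V → V → ℝ := fun x y => if G.Adj x y then spinR (σ x) * spinR (σ y) else 0 with hA
  have hsymm : ∀ x y, A x y = A y x := fun x y => by
    simp only [hA, G.adj_comm x y, mul_comm (spinR (σ x))]
  have e0 : ∑ x, ∑ y, A x y = ∑ x ∈ B, ∑ y ∈ B, A x y + 2 * ∑ x ∈ B, ∑ y ∈ Bᶜ, A x y +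
      ∑ x ∈ Bᶜ, ∑ y ∈ Bᶜ, A x y := by
    have e1 : ∑ x ∈ Bᶜ, ∑ y ∈ B, A x y = ∑ x ∈ B, ∑ y ∈ Bᶜ, A x y := by
      rw [Finset.sum_comm]
      exact Finset.sum_congr rfl fun x _ => Finset.sum_congr rfl fun y _ => hsymm _ _
    have e2 : ∀ x, ∑ y, A x y = ∑ y ∈ B, A x y + ∑ y ∈ Bᶜ, A x y := fun x =>
      (Finset.sum_add_sum_compl B _).symm
    rw [← Finset.sum_add_sum_compl B]
    simp only [e2, Finset.sum_add_distrib, e1]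
    ring
  have e3 : ∑ x ∈ B, extField G β B η x * spinR (σ x) = β * ∑ x ∈ B, ∑ y ∈ Bᶜ, A x y := by
    rw [Finset.mul_sum]
    refine Finset.sum_congr rfl fun x hx => ?_
    rw [extField, if_pos hx, mul_assoc, Finset.sum_mul]
    congr 1
    refine Finset.sum_congr rfl fun y hy => ?_
    simp only [hA, h y (Finset.mem_compl.1 hy)]
    split_ifs <;> ring
  have e4 : extEnergy G β B η = β * ((1 / 2) * ∑ x ∈ Bᶜ, ∑ y ∈ Bᶜ, A x y) := by
    unfold extEnergy
    congr 2
    refine Finset.sum_congr rfl fun x hx => Finset.sum_congr rfl fun y hy => ?_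
    simp only [hA, h y (Finset.mem_compl.1 hy), h x (Finset.mem_compl.1 hx)]
  unfold isingInteraction fieldEnergy
  rw [e3, e4, e0]
  ring

lemma sum_filter_agree_eq (B : Finset V) (η : V → Bool) (F : (V → Bool) → ℝ) :
    ∑ σ ∈ univ.filter (fun σ : V → Bool => ∀ v ∈ Bᶜ, σ v = η v), F σ =
      ∑ t ∈ B.powerset, F (B.piecewise (indSpin t) η) := by
  refine Finset.sum_nbij' (fun σ => B.filter fun x => σ x = true)
    (fun t => B.piecewise (indSpin t) η) (fun σ _ => by simp) (fun t _ => ?_) (fun σ hσ => ?_)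
    (fun t ht => ?_) (fun σ hσ => ?_)
  · simp only [Finset.mem_filter, mem_univ, true_and, Finset.mem_compl]
    exact fun v hv => Finset.piecewise_eq_of_notMem _ _ _ hv
  · simp only [Finset.mem_filter, mem_univ, true_and, Finset.mem_compl] at hσ
    funext x
    by_cases hx : x ∈ B
    · simp [hx, indSpin]
    · simp [hx, hσ x hx]
  · ext x
    have : x ∈ t → x ∈ B := fun e => Finset.mem_powerset.1 ht e
    by_cases hx : x ∈ B
    · simp [hx, indSpin]
    · simpa [hx] using fun e => hx (this e)
  · simp only [Finset.mem_filter, mem_univ, true_and, Finset.mem_compl] at hσ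
    congr 1
    funext x
    by_cases hx : x ∈ B
    · simp [hx, indSpin]
    · simp [hx, hσ x hx]

lemma cexp_isingPMF (B : Finset V) (f : (V → Bool) → ℝ) (η : V → Bool) :
    cexp (isingPMF G β) Bᶜ f η =
      (∑ t ∈ B.powerset, Real.exp (fieldEnergy G β B (extField G β B η) (indSpin t)) *
        f (B.piecewise (indSpin t) η)) / fieldZ G β B (extField G β B η) := by
  set c := Real.exp (extEnergy G β B η) / ∑ τ : V → Bool, Real.exp (β * isingInteraction G τ)
    with hc
  have hc0 : 0 < c := div_pos (Real.exp_pos _)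
    (Finset.sum_pos (fun _ _ => Real.exp_pos _) univ_nonempty)
  have key : ∀ t, isingPMF G β (B.piecewise (indSpin t) η) =
      c * Real.exp (fieldEnergy G β B (extField G β B η) (indSpin t)) := by
    intro t
    unfold isingPMF
    rw [mul_isingInteraction_eq (η := η) (B := B)
      (fun x hx => Finset.piecewise_eq_of_notMem _ _ _ hx), Real.exp_add,
      fieldEnergy_congr (h' := extField G β B η) (σ' := indSpin t) (fun _ _ => rfl)
        (fun x hx => Finset.piecewise_eq_of_mem _ _ _ hx), hc]
    ring
  unfold cexp
  rw [sum_filter_agree_eq, sum_filter_agree_eq]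
  simp only [key, mul_assoc, ← Finset.mul_sum]
  rw [mul_div_mul_left _ _ hc0.ne']
  rfl

lemma cexp_singleton_compl (w : V) (f : (V → Bool) → ℝ) (η : V → Bool) :
    cexp (isingPMF G β) {w}ᶜ f η =
      (Real.exp (extField G β {w} η w) * f (Function.update η w true) +
        Real.exp (-extField G β {w} η w) * f (Function.update η w false)) /
        (Real.exp (extField G β {w} η w) + Real.exp (-extField G β {w} η w)) := by
  have h1 : ∀ t : Finset V, ({w} : Finset V).piecewise (indSpin t) η =
      Function.update η w (indSpin t w) := fun t => Finset.piecewise_singleton _ _ _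
  have hp : ({w} : Finset V).powerset = {∅, {w}} := rfl
  have hE : ∀ σ, fieldEnergy G β {w} (extField G β {w} η) σ =
      extField G β {w} η w * spinR (σ w) := fun σ => by
    simp [fieldEnergy]
  rw [cexp_isingPMF]
  simp only [fieldZ, h1, hE]
  rw [hp, Finset.sum_pair (Finset.singleton_ne_empty w).symm,
    Finset.sum_pair (Finset.singleton_ne_empty w).symm]
  simp only [indSpin, spinR, Finset.notMem_empty, decide_false, Finset.mem_singleton, decide_true]
  simp only [if_true, Bool.false_eq_true, if_false, mul_one, mul_neg]
  rw [add_comm, add_comm (Real.exp (-_))]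

lemma extField_congr {B : Finset V} {w : V} {η η' : V → Bool}
    (h : ∀ x, G.Adj w x → η x = η' x) : extField G β B η w = extField G β B η' w := by
  unfold extField
  congr 2
  refine Finset.sum_congr rfl fun x _ => ?_
  split_ifs with hx
  · rw [h x hx]
  · rfl

lemma siteLocal_isingPMF {B C : Finset V} (hBC : ∀ w ∈ B, ∀ x, G.Adj w x → x ∈ C) :
    SiteLocal (isingPMF G β) B C := by
  intro w hw f hf ω ω' h
  have hu : ∀ b, f (Function.update ω' w b) = f (Function.update ω w b) := fun b =>
    hf _ _ fun v hv => by
      by_cases e : v = w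
      · subst e; simp
      · simp [e, h v hv]
  rw [cexp_singleton_compl, cexp_singleton_compl, hu, hu,
    extField_congr fun x hx => h x (hBC w hw x hx)]

lemma abs_extField_le (hβ : 0 ≤ β) {d : ℕ} (hdeg : ∀ v, G.degree v ≤ d) (B : Finset V)
    (η : V → Bool) (w : V) : |extField G β B η w| ≤ β * d := by
  unfold extField
  split_ifs
  · rw [abs_mul, abs_of_nonneg hβ]
    refine mul_le_mul_of_nonneg_left ?_ hβ
    refine (Finset.abs_sum_le_sum_abs _ _).trans ?_
    calc _ ≤ ∑ x ∈ Bᶜ, if G.Adj w x then (1 : ℝ) else 0 := Finset.sum_le_sum fun x _ => by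
          split_ifs
          · rw [spinR_abs]
          · simp
      _ = ((Bᶜ.filter (G.Adj w)).card : ℝ) := by simp
      _ ≤ d := by exact_mod_cast (card_filter_adj_le _ w).trans (hdeg w)
  · simpa using by positivity

lemma siteBound_isingPMF (hβ : 0 ≤ β) {d : ℕ} (hdeg : ∀ v, G.degree v ≤ d) :
    SiteBound (isingPMF G β) (1 / (1 + Real.exp (2 * (β * d)))) := by
  intro h h0 w σ b
  rw [cexp_singleton_compl]
  have hx := abs_le.1 (abs_extField_le hβ hdeg {w} σ w)
  generalize extField G β {w} σ w = x at *
  have main : ∀ x y z : ℝ, -(β * d) ≤ x → 0 ≤ y → 0 ≤ z →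
      1 / (1 + Real.exp (2 * (β * d))) * y ≤
        (Real.exp x * y + Real.exp (-x) * z) / (Real.exp x + Real.exp (-x)) := by
    intro x y z hx hy hz
    rw [one_div_mul_eq_div, div_le_div_iff₀ (by positivity) (by positivity)]
    have h1 : Real.exp (-x) ≤ Real.exp (2 * (β * d)) * Real.exp x := by
      rw [← Real.exp_add]; exact Real.exp_le_exp.2 (by linarith)
    have h2 := mul_le_mul_of_nonneg_right h1 hy
    have h3 : 0 ≤ Real.exp (-x) * z * (1 + Real.exp (2 * (β * d))) := by positivity
    nlinarith
  cases b
  · have := main (-x) _ _ (by linarith [hx.2]) (h0 (Function.update σ w false))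
      (h0 (Function.update σ w true))
    rwa [neg_neg, add_comm (Real.exp (-x) * _), add_comm (Real.exp (-x))] at this
  · exact main x _ _ hx.1 (h0 _) (h0 _)

end Ising

end SR
namespace SR

section Oscillation

lemma abs_one_sub_two_div_sub_le (x y : ℝ) :
    |(1 - 2 / (Real.exp x + 1)) - (1 - 2 / (Real.exp y + 1))| ≤ |x - y| := by
  have hd : ∀ z, HasDerivAt (fun z => 1 - 2 / (Real.exp z + 1))
      (2 * Real.exp z / (Real.exp z + 1) ^ 2) z := by
    intro z
    have h1 := ((hasDerivAt_const z (2 : ℝ)).div ((Real.hasDerivAt_exp z).add_const 1)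
      (by positivity)).const_sub 1
    refine h1.congr_deriv ?_
    ring
  have := Convex.norm_image_sub_le_of_norm_hasDerivWithin_le (s := Set.univ) (C := 1)
    (fun z _ => (hd z).hasDerivWithinAt) (fun z _ => ?_) convex_univ
    (Set.mem_univ y) (Set.mem_univ x)
  · simpa [Real.norm_eq_abs] using this
  · rw [Real.norm_of_nonneg (by positivity), div_le_one (by positivity)]
    nlinarith [sq_nonneg (Real.exp z)]

variable {V : Type*} [Fintype V] [DecidableEq V] {G : SimpleGraph V} [DecidableRel G.Adj] {β : ℝ}

lemma cexp_isingPMF_spinAt {B : Finset V} {v : V} (hv : v ∉ B) (η : V → Bool) :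
    cexp (isingPMF G β) (insert v B)ᶜ (spinAt v) η =
      1 - 2 / (Real.exp (logRatio G β B v (extField G β (insert v B) η)) + 1) := by
  have e : ∀ t : Finset V, spinAt v ((insert v B).piecewise (indSpin t) η) =
      id (spinR (indSpin t v)) := fun t => by simp [spinAt]
  rw [cexp_isingPMF]
  simp only [e]
  rw [sum_powerset_insert_exp hv, fieldZ_insert hv, exp_logRatio]
  set h := extField G β (insert v B) η
  have hA := mul_pos (Real.exp_pos (h v))
    (fieldZ_pos (G := G) (β := β) B (bump (B.filter (G.Adj v)) β h))
  have hB := mul_pos (Real.exp_pos (-h v))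
    (fieldZ_pos (G := G) (β := β) B (bump (B.filter (G.Adj v)) (-β) h))
  generalize Real.exp (h v) * _ = X at *
  generalize Real.exp (-h v) * _ = Y at *
  simp only [id]
  field_simp
  ring

lemma abs_extField_update_sub (hβ : 0 ≤ β) (B : Finset V) (η : V → Bool) (u w : V) :
    |extField G β B (Function.update η u true) w - extField G β B (Function.update η u false) w| ≤
      if w ∈ B then (if u ∉ B ∧ G.Adj w u then 2 * β else 0) else 0 := by
  unfold extField
  split_ifs with hw hu
  · obtain ⟨huB, hwu⟩ := hu
    rw [← mul_sub, ← Finset.sum_sub_distrib, abs_mul, abs_of_nonneg hβ, mul_comm]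
    refine mul_le_mul_of_nonneg_right ?_ hβ
    rw [Finset.sum_eq_single_of_mem u (Finset.mem_compl.2 huB)]
    · norm_num [hwu, spinR]
    · intro x _ hx
      simp [Function.update_of_ne hx]
  · rw [← mul_sub, ← Finset.sum_sub_distrib, Finset.sum_eq_zero]
    · simp
    · intro x hx
      by_cases hxu : x = u
      · subst hxu
        have : ¬ G.Adj w x := fun h => hu ⟨Finset.mem_compl.1 hx, h⟩
        simp [this]
      · simp [Function.update_of_ne hxu]
  · simp

/-- Oscillations of the conditional expectation of a spin given the configuration outside a block
decay when the weights `φ` are small on the boundary of the block. -/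
lemma exists_osc_le (hβ : 0 ≤ β) {d : ℕ} (hdeg : ∀ v, G.degree v ≤ d)
    {φ : V → ℝ} {lam K : ℝ} (hφ0 : ∀ v, 0 ≤ φ v) (hlam : 0 ≤ lam)
    (hφ : ∀ v w, G.Adj v w → φ w ≤ lam * φ v) (hK : 0 ≤ K)
    (hKeq : 2 + Real.tanh β * (d - 1 : ℕ) * (K * lam) ≤ K) {B : Finset V} {v : V} (hv : v ∈ B)
    {R : ℝ} (hR0 : 0 ≤ R) (hR : ∀ w ∈ B, ∀ u ∉ B, G.Adj w u → 1 ≤ R * φ w) :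
    ∃ b : V → ℝ, (∀ u, 0 ≤ b u) ∧
      ∑ u, b u ≤ β * d * R * ((2 + Real.tanh β * d * (K * lam)) * φ v) ∧
      ∀ σ u, cexp (isingPMF G β) Bᶜ (spinAt v) (Function.update σ u true) -
        cexp (isingPMF G β) Bᶜ (spinAt v) (Function.update σ u false) ≤ 2 * b u := by
  obtain ⟨a, ⟨ha0, ha⟩, hsum⟩ := exists_influence hβ hdeg hφ0 hlam hφ hK hKeq
    (Finset.notMem_erase v B)
  refine ⟨fun u => β * ∑ w ∈ B, if u ∉ B ∧ G.Adj w u then a w else 0, fun u =>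
    mul_nonneg hβ (Finset.sum_nonneg fun w _ => ?_), ?_, fun σ u => ?_⟩
  · split_ifs
    exacts [ha0 w, le_rfl]
  · rw [← Finset.mul_sum, Finset.sum_comm, mul_assoc, mul_assoc]
    refine mul_le_mul_of_nonneg_left ?_ hβ
    have h1 : ∀ w ∈ B, ∑ u, (if u ∉ B ∧ G.Adj w u then a w else 0) ≤ d * (R * (a w * φ w)) := by
      intro w hw
      by_cases hex : ∃ u, u ∉ B ∧ G.Adj w u
      · obtain ⟨u, huB, hwu⟩ := hex
        have hle : a w ≤ R * (a w * φ w) := by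
          have := mul_le_mul_of_nonneg_left (hR w hw u huB hwu) (ha0 w)
          linarith
        have hcard : (univ.filter fun u => u ∉ B ∧ G.Adj w u).card ≤ d := by
          refine le_trans (Finset.card_le_card fun x hx => ?_)
            ((card_filter_adj_le univ w).trans (hdeg w))
          simp only [Finset.mem_filter, mem_univ, true_and] at hx ⊢
          exact hx.2
        rw [← Finset.sum_filter, Finset.sum_const, nsmul_eq_mul]
        exact mul_le_mul (by exact_mod_cast hcard) hle (ha0 w) (by positivity)
      · push Not at hex
        rw [Finset.sum_eq_zero fun u _ => if_neg fun h => hex u h.1 h.2]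
        exact mul_nonneg (Nat.cast_nonneg d) (mul_nonneg hR0 (mul_nonneg (ha0 w) (hφ0 w)))
    calc _ ≤ ∑ w ∈ B, d * (R * (a w * φ w)) := Finset.sum_le_sum h1
      _ ≤ ∑ w, d * (R * (a w * φ w)) := Finset.sum_le_univ_sum_of_nonneg fun w =>
          mul_nonneg (Nat.cast_nonneg d) (mul_nonneg hR0 (mul_nonneg (ha0 w) (hφ0 w)))
      _ = d * (R * ∑ w, a w * φ w) := by simp only [Finset.mul_sum]
      _ ≤ _ := by gcongr
  · have hins : insert v (B.erase v) = B := Finset.insert_erase hv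
    have h1 := cexp_isingPMF_spinAt (G := G) (β := β) (Finset.notMem_erase v B)
    rw [hins] at h1
    rw [h1, h1]
    refine (le_abs_self _).trans ((abs_one_sub_two_div_sub_le _ _).trans ((ha _ _).trans ?_))
    calc _ ≤ ∑ w, a w * if w ∈ B then (if u ∉ B ∧ G.Adj w u then 2 * β else 0) else 0 :=
          Finset.sum_le_sum fun w _ =>
            mul_le_mul_of_nonneg_left (abs_extField_update_sub hβ B σ u w) (ha0 w)
      _ = ∑ w ∈ B, a w * (if u ∉ B ∧ G.Adj w u then 2 * β else 0) := by
          simp [mul_ite]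
      _ = _ := by
          rw [← mul_assoc, Finset.mul_sum]
          refine Finset.sum_congr rfl fun w _ => ?_
          split_ifs <;> ring

end Oscillation

section Ball

variable {V : Type*} [Fintype V] [DecidableEq V] (G : SimpleGraph V) [DecidableRel G.Adj]

/-- The ball of radius `k` around `v` in `G`. -/
def gball (v : V) : ℕ → Finset V
  | 0 => {v}
  | k + 1 => gball v k ∪ (gball v k).biUnion fun w => G.neighborFinset w

variable {G}

lemma gball_mono (v : V) : Monotone (gball G v) :=
  monotone_nat_of_le_succ fun _ => Finset.subset_union_left

lemma mem_gball_self (v : V) (k : ℕ) : v ∈ gball G v k :=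
  gball_mono v (Nat.zero_le k) (Finset.mem_singleton_self v)

lemma mem_gball_succ {v w x : V} {k : ℕ} (hw : w ∈ gball G v k) (h : G.Adj w x) :
    x ∈ gball G v (k + 1) :=
  Finset.mem_union_right _ (Finset.mem_biUnion.2 ⟨w, hw, by simpa using h⟩)

lemma card_gball_le {d : ℕ} (hdeg : ∀ v, G.degree v ≤ d) (v : V) (k : ℕ) :
    (gball G v k).card ≤ (d + 1) ^ k := by
  induction k with
  | zero => simp [gball]
  | succ k ih =>
    calc _ ≤ (gball G v k).card + ((gball G v k).biUnion fun w => G.neighborFinset w).card :=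
          Finset.card_union_le _ _
      _ ≤ (gball G v k).card + (gball G v k).card * d :=
          add_le_add_right (Finset.card_biUnion_le_card_mul _ _ _ fun w _ => by
            rw [G.card_neighborFinset_eq_degree]; exact hdeg w) _
      _ = (gball G v k).card * (d + 1) := by ring
      _ ≤ _ := by rw [pow_succ]; exact Nat.mul_le_mul_right _ ih

/-- The distance to `v`, truncated at `r`. -/
def truncDist (G : SimpleGraph V) [DecidableRel G.Adj] (v : V) (r : ℕ) (w : V) : ℕ :=
  ((Finset.range r).filter fun k => w ∉ gball G v k).card

lemma truncDist_self (v : V) (r : ℕ) : truncDist G v r v = 0 := by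
  simp [truncDist, mem_gball_self]

lemma truncDist_le_succ (v : V) (r : ℕ) {w x : V} (h : G.Adj w x) :
    truncDist G v r x ≤ truncDist G v r w + 1 := by
  unfold truncDist
  calc _ ≤ (insert 0 (((Finset.range r).filter fun k => w ∉ gball G v k).image Nat.succ)).card := by
        refine Finset.card_le_card fun k hk => ?_
        obtain ⟨hkr, hk⟩ := Finset.mem_filter.1 hk
        rw [Finset.mem_range] at hkr
        cases k with
        | zero => simp
        | succ k =>
          refine Finset.mem_insert_of_mem (Finset.mem_image.2 ⟨k, ?_, rfl⟩)
          exact Finset.mem_filter.2 ⟨Finset.mem_range.2 (by omega), fun hw =>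
            hk (mem_gball_succ hw h)⟩
    _ ≤ _ := (Finset.card_insert_le _ _).trans (Nat.add_le_add_right Finset.card_image_le 1)

lemma truncDist_boundary {v : V} {r : ℕ} {w u : V} (hu : u ∉ gball G v r) (h : G.Adj w u) :
    truncDist G v r w = r := by
  unfold truncDist
  rw [Finset.filter_true_of_mem, Finset.card_range]
  intro k hk hw
  exact hu (gball_mono v (Nat.succ_le_of_lt (Finset.mem_range.1 hk)) (mem_gball_succ hw h))

end Ball

end SR
namespace SR

section Assembly

/-- Below the tree uniqueness threshold there is a growth rate `lam > 1` for which the weighted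
sums of influences along a tree of degree `d` converge. -/
lemma exists_growth_rate {d : ℕ} (hd : 2 ≤ d) {β : ℝ} (hβ0 : 0 ≤ β)
    (hβ : Real.tanh β < 1 / ((d : ℝ) - 1)) : ∃ lam K : ℝ, 1 < lam ∧ 0 ≤ K ∧
      2 + Real.tanh β * (d - 1 : ℕ) * (K * lam) ≤ K := by
  have hd' : (2 : ℝ) ≤ d := by exact_mod_cast hd
  have hcast : ((d - 1 : ℕ) : ℝ) = d - 1 := by
    rw [Nat.cast_sub (by omega), Nat.cast_one]
  set θ := Real.tanh β * (d - 1 : ℕ) with hθ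
  have hθ0 : 0 ≤ θ := mul_nonneg (tanh_nonneg_of_nonneg hβ0) (Nat.cast_nonneg _)
  have hθ1 : θ < 1 := by
    rw [hθ, hcast]
    rwa [lt_div_iff₀ (by linarith)] at hβ
  refine ⟨2 / (1 + θ), 2 * (1 + θ) / (1 - θ), ?_, ?_, le_of_eq ?_⟩
  · rw [lt_div_iff₀ (by linarith)]; linarith
  · have : 0 ≤ 1 - θ := by linarith
    positivity
  · have h1 : 1 - θ ≠ 0 := by linarith
    have h2 : 1 + θ ≠ 0 := by linarith
    field_simp
    ring

/-- Below the tree uniqueness threshold, the spin at `v` depends little on the configuration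
outside of a large ball around `v`, uniformly over the graphs of maximum degree at most `d`. -/
lemma exists_radius {d : ℕ} (hd : 2 ≤ d) {β : ℝ} (hβ0 : 0 ≤ β)
    (hβ : Real.tanh β < 1 / ((d : ℝ) - 1)) {ε : ℝ} (hε : 0 < ε) :
    ∃ r : ℕ, ∀ (V : Type) [Fintype V] [DecidableEq V] (G : SimpleGraph V) [DecidableRel G.Adj],
      (∀ v : V, G.degree v ≤ d) → ∀ v : V, ∃ b : V → ℝ, (∀ u, 0 ≤ b u) ∧ ∑ u, b u ≤ ε ∧
        ∀ σ u, cexp (isingPMF G β) (gball G v r)ᶜ (spinAt v) (Function.update σ u true) -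
          cexp (isingPMF G β) (gball G v r)ᶜ (spinAt v) (Function.update σ u false) ≤
            2 * b u := by
  obtain ⟨lam, K, hlam, hK, hKeq⟩ := exists_growth_rate hd hβ0 hβ
  have hlam0 : 0 < lam := by linarith
  set C := β * d * (2 + Real.tanh β * d * (K * lam)) with hC
  have hC0 : 0 ≤ C := by
    have := tanh_nonneg_of_nonneg hβ0
    positivity
  obtain ⟨r, hr⟩ := exists_pow_lt_of_lt_one (show 0 < ε / (C + 1) by positivity)
    (inv_lt_one_of_one_lt₀ hlam)
  refine ⟨r, fun V _ _ G _ hdeg v => ?_⟩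
  obtain ⟨b, hb0, hb1, hb2⟩ := exists_osc_le hβ0 hdeg (φ := fun w => lam ^ truncDist G v r w)
    (lam := lam) (K := K) (B := gball G v r) (v := v) (R := lam⁻¹ ^ r)
    (fun w => by positivity) hlam0.le (fun w x hwx => by
      rw [← pow_succ']
      exact pow_le_pow_right₀ hlam.le (truncDist_le_succ v r hwx)) hK hKeq (mem_gball_self v r)
    (by positivity) (fun w _ u hu hwu => by
      rw [truncDist_boundary hu hwu, ← mul_pow, inv_mul_cancel₀ hlam0.ne', one_pow])
  refine ⟨b, hb0, hb1.trans ?_, hb2⟩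
  rw [truncDist_self, pow_zero, mul_one]
  have h1 : (C + 1) * lam⁻¹ ^ r ≤ ε := by
    rw [lt_div_iff₀ (by positivity)] at hr
    linarith
  have h2 : 0 ≤ lam⁻¹ ^ r := by positivity
  calc _ = C * lam⁻¹ ^ r := by rw [hC]; ring
    _ ≤ ε := by linarith

lemma isingPMF_halving {V : Type} [Fintype V] [DecidableEq V] {G : SimpleGraph V}
    [DecidableRel G.Adj] {β : ℝ} (hβ : 0 ≤ β) {d : ℕ} (hdeg : ∀ v, G.degree v ≤ d)
    {ν : Finset V → ℝ} (hν : IsSubsetDist ν) {δ : ℝ} (hδ0 : 0 ≤ δ) (hδ1 : δ ≤ 1)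
    (hδ : ∀ w, ∑ S ∈ univ.filter (fun S : Finset V => w ∈ S), ν S ≤ δ) {r k n : ℕ}
    (hr : ∀ v : V, ∃ b : V → ℝ, (∀ u, 0 ≤ b u) ∧ ∑ u, b u ≤ 1 / 4 ∧
      ∀ σ u, cexp (isingPMF G β) (gball G v r)ᶜ (spinAt v) (Function.update σ u true) -
        cexp (isingPMF G β) (gball G v r)ᶜ (spinAt v) (Function.update σ u false) ≤ 2 * b u)
    (hk : ((d : ℝ) + 1) ^ (r + 1) * (2 * (1 - ((1 - δ) * (1 / (1 + Real.exp (2 * (β * d))))) ^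
      (d + 1) ^ r) ^ k) ≤ 1 / 4)
    (hn : k * (d + 1) ^ r ≤ n) : Halving (isingPMF G β) (revealOp (isingPMF G β) ν) n := by
  intro v
  have hp : IsFKG (isingPMF G β) := isFKG_isingPMF hβ
  obtain ⟨b, hb0, hb1, hb2⟩ := hr v
  set κ := 1 / (1 + Real.exp (2 * (β * d))) with hκdef
  have hκ0 : 0 ≤ κ := by positivity
  have hκ1 : κ ≤ 1 := by
    rw [hκdef, div_le_one (by positivity)]
    linarith [Real.exp_pos (2 * (β * d))]
  have hq0 : 0 ≤ 1 - δ := by linarith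
  have hq1 : 1 - δ ≤ 1 := by linarith
  have hqκ0 : 0 ≤ (1 - δ) * κ := mul_nonneg hq0 hκ0
  have hqκ1 : (1 - δ) * κ ≤ 1 := mul_le_one₀ hq1 hκ0 hκ1
  set l := (gball G v r).toList with hl
  have hlen : l.length ≤ (d + 1) ^ r := by
    rw [hl, Finset.length_toList]
    exact card_gball_le hdeg v r
  set x := 2 * (1 - ((1 - δ) * κ) ^ l.length) ^ k with hx
  have hx0 : 0 ≤ x := by
    have : 0 ≤ 1 - ((1 - δ) * κ) ^ l.length := by linarith [pow_le_one₀ (n := l.length) hqκ0 hqκ1]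
    positivity
  have hxle : x ≤ 2 * (1 - ((1 - δ) * κ) ^ (d + 1) ^ r) ^ k := by
    have h1 := pow_le_pow_of_le_one hqκ0 hqκ1 hlen
    have h2 : 0 ≤ 1 - ((1 - δ) * κ) ^ l.length := by
      linarith [pow_le_one₀ (n := l.length) hqκ0 hqκ1]
    exact mul_le_mul_of_nonneg_left (pow_le_pow_left₀ h2 (by linarith) k) (by norm_num)
  refine ⟨fun u => b u + if u ∈ gball G v (r + 1) then x else 0, fun u => ?_, ?_,
    fun f hf => ?_⟩
  · have := hb0 u
    dsimp only
    split_ifs <;> linarith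
  · have hcard : ((gball G v (r + 1)).card : ℝ) ≤ ((d : ℝ) + 1) ^ (r + 1) := by
      exact_mod_cast card_gball_le hdeg v (r + 1)
    have h1 : ((gball G v (r + 1)).card : ℝ) * x ≤ 1 / 4 :=
      (mul_le_mul hcard hxle hx0 (by positivity)).trans hk
    rw [Finset.sum_add_distrib, Finset.sum_ite_mem, Finset.univ_inter, Finset.sum_const,
      nsmul_eq_mul]
    linarith
  · have hflat : (List.replicate k l).flatten.length ≤ n := by
      rw [List.length_flatten, List.map_replicate, List.sum_replicate, smul_eq_mul]
      exact (Nat.mul_le_mul_left k hlen).trans hn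
    have h1 := hp.covLE_pow_sweep hν hδ0 hδ1 hδ _ hflat f _ hf (monotone_spinAt v)
    rw [sweep_replicate_flatten] at h1
    refine h1.trans (hp.covF_le_sum hf ?_)
    exact hp.sweep_pow_spinAt_sub_le (siteBound_isingPMF hβ hdeg) hκ0 hq0 hq1
      (siteLocal_isingPMF fun w hw y hy => mem_gball_succ hw hy) (fun w => Finset.mem_toList)
      (mem_gball_self v (r + 1)) hb0 hb2 k

end Assembly

end SR

/-- **No random sparse reconstruction for Ising below the tree uniqueness threshold**
(Theorem 1.10 of the paper). For every maximal degree `d`, every `0 < β` with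
`tanh β < 1/(d−1)` (i.e. `β < β_c(d)`, the tree uniqueness threshold), and every `δ ∈ (0,1)`,
there is a constant `c < 1` such that for every finite graph of maximal degree at most `d`,
every function of the Ising spins, and every independent random subset of revealment at most
`δ`, the expected clue is at most `c`. -/
theorem no_RSR_ising_tree_uniqueness
    (d : ℕ) (hd : 2 ≤ d) (β : ℝ) (hβ0 : 0 < β)
    (hβ : Real.tanh β < 1 / ((d : ℝ) - 1))
    (δ : ℝ) (hδ0 : 0 < δ) (hδ1 : δ < 1) :
    ∃ c : ℝ, c < 1 ∧
      ∀ (V : Type) [Fintype V] [DecidableEq V]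
        (G : SimpleGraph V) [DecidableRel G.Adj],
        (∀ v : V, G.degree v ≤ d) →
        ∀ (f : (V → Bool) → ℝ) (ν : Finset V → ℝ), IsSubsetDist ν →
        (∀ v : V, ∑ S ∈ Finset.univ.filter (fun S : Finset V => v ∈ S), ν S ≤ δ) →
        eClue (isingPMF G β) f ν ≤ c := by

  obtain ⟨r, hr⟩ := exists_radius hd hβ0.le hβ (ε := 1 / 4) (by norm_num)
  set ε := ((1 - δ) * (1 / (1 + Real.exp (2 * (β * d))))) ^ (d + 1) ^ r with hε
  have hq : 0 < 1 - δ := by linarith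
  have hε0 : 0 < ε := by positivity
  obtain ⟨k, hk⟩ := exists_pow_lt_of_lt_one
    (show 0 < 1 / (8 * ((d : ℝ) + 1) ^ (r + 1)) by positivity) (show 1 - ε < 1 by linarith)
  have hk' : ((d : ℝ) + 1) ^ (r + 1) * (2 * (1 - ε) ^ k) ≤ 1 / 4 := by
    rw [lt_div_iff₀ (by positivity)] at hk
    linarith
  set t := k * (d + 1) ^ r
  have hc0 : (0 : ℝ) ≤ (1 / 2 : ℝ) ^ (((2 ^ t : ℕ) : ℝ)⁻¹) := by positivity
  refine ⟨(1 / 2 : ℝ) ^ (((2 ^ t : ℕ) : ℝ)⁻¹),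
    Real.rpow_lt_one (by norm_num) (by norm_num) (by positivity), ?_⟩
  intro V _ _ G _ hdeg f ν hν hrev
  exact (isFKG_isingPMF hβ0.le).eClue_le hν.1
    (isingPMF_halving hβ0.le hdeg hν hδ0.le hδ1.le hrev (hr V G hdeg) hk'
      Nat.lt_two_pow_self.le) hc0
    (Real.rpow_inv_natCast_pow (by norm_num) (by positivity)) f
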